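/- For any permutation ω ∈ S_n, the pipe dream congruence ≡_ω is a lattice congruence of the weak order interval [e,ω]: if π ≡_ω π′ and σ ≡_ω σ′ then π ∧ σ ≡_ω π′ ∧ σ′ and π ∨ σ ≡_ω π′ ∨ σ′, where ∧ and ∨ are the meet and join of the lattice [e,ω]. -/

import Mathlib

/-- A pipe dream of size `n` on the triangular shape, with boxes indexed by pairs
`(r, c)` of a row `r` and a column `c`, both `0`-indexed (rows increase southwards,
columns increase eastwards).  `cross r c = true` means that box `(r, c)` contains a
crossing tile; all other boxes contain elbow tiles.  Crossings are only allowed in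
the full boxes of the triangular shape, i.e. those with `r + c + 2 ≤ n` (the boxes
with `r + c + 1 = n` are the half-boxes on the antidiagonal, which are forced
elbows).  The `n` pipes enter horizontally on the left side in rows `0, …, n-1` and
exit vertically on the top side in columns `0, …, n-1`; pipe `k` is the pipe
entering at row `k`.  An elbow tile connects the west edge of its box to the north
edge (the pipe travelling through this elbow passes northwest of the tile) and the
south edge to the east edge (this pipe passes southeast of the tile); a crossing
tile connects west to east and south to north. -/
structure PipeDream (n : ℕ) where
  cross : ℕ → ℕ → Bool
  inShape : ∀ r c : ℕ, cross r c = true → r + c + 2 ≤ n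

namespace PipeDream

variable {n : ℕ}

/-- `(P.pipes r c).1` is the label of the pipe entering box `(r, c)` from the west,
and `(P.pipes r c).2` is the label of the pipe entering box `(r, c)` from the south
(junk value `0` if there is no box below box `(r, c)` in the triangular shape). -/
def pipes (P : PipeDream n) : ℕ → ℕ → ℕ × ℕ
  | r, c =>
    (if hc : c = 0 then r
      else if P.cross r (c - 1) then (pipes P r (c - 1)).1 else (pipes P r (c - 1)).2,
     if hr : r + c + 2 ≤ n then
        if P.cross (r + 1) c then (pipes P (r + 1) c).2 else (pipes P (r + 1) c).1
      else 0)
  termination_by r c => (n - r) + c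
  decreasing_by all_goals omega

/-- The pipe entering box `(r, c)` from the west (travelling eastwards). -/
def west (P : PipeDream n) (r c : ℕ) : ℕ := (pipes P r c).1

/-- The pipe entering box `(r, c)` from the south (travelling northwards). -/
def south (P : PipeDream n) (r c : ℕ) : ℕ := (pipes P r c).2

/-- The pipe exiting on the top side at column `c`. -/
def exitPipe (P : PipeDream n) (c : ℕ) : ℕ :=
  if P.cross 0 c then P.south 0 c else P.west 0 c

/-- `P` has exit permutation `ω`, i.e. the pipe exiting at column `c` is `ω c`;
equivalently, pipe `k` exits at column `ω⁻¹ k`. -/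
def HasExitPerm (P : PipeDream n) (ω : Equiv.Perm (Fin n)) : Prop :=
  ∀ c : Fin n, P.exitPipe c.val = (ω c).val

/-- `P` is reduced: any two of its pipes cross at most once. -/
def Reduced (P : PipeDream n) : Prop :=
  ∀ r c r' c' : ℕ, P.cross r c = true → P.cross r' c' = true → (r, c) ≠ (r', c') →
    ¬ ((P.west r c = P.west r' c' ∧ P.south r c = P.south r' c') ∨
        (P.west r c = P.south r' c' ∧ P.south r c = P.west r' c'))

/-- The arcs of the contact graph `P♯` of `P`: there is one arc for each elbow
contact of `P` (an elbow tile in a full box of the triangular shape), oriented from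
the pipe passing northwest of the contact (the one travelling west-to-north) to the
pipe passing southeast of it (the one travelling south-to-east). -/
def Arc (P : PipeDream n) (i j : ℕ) : Prop :=
  ∃ r c : ℕ, r + c + 2 ≤ n ∧ P.cross r c = false ∧ P.west r c = i ∧ P.south r c = j

/-- `P` is acyclic: its contact graph has no directed cycle. -/
def Acyclic (P : PipeDream n) : Prop := ∀ i : ℕ, ¬ Relation.TransGen P.Arc i i

/-- `i ⪯_P j` : there is a directed path (possibly empty) from `i` to `j` in the
contact graph of `P`. -/
def Path (P : PipeDream n) (i j : ℕ) : Prop := Relation.ReflTransGen P.Arc i j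

/-- `π` is a linear extension of `P` : `π⁻¹ i < π⁻¹ j` for every arc `i → j` of the
contact graph of `P`. -/
def LinExt (P : PipeDream n) (π : Equiv.Perm (Fin n)) : Prop :=
  ∀ i j : Fin n, P.Arc i.val j.val → π⁻¹ i < π⁻¹ j

/-- There is a contact (an elbow tile in a full box) between pipes `i` and `j`
at box `b`. -/
def ContactAt (P : PipeDream n) (i j : ℕ) (b : ℕ × ℕ) : Prop :=
  b.1 + b.2 + 2 ≤ n ∧ P.cross b.1 b.2 = false ∧
    ((P.west b.1 b.2 = i ∧ P.south b.1 b.2 = j) ∨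
      (P.west b.1 b.2 = j ∧ P.south b.1 b.2 = i))

/-- `P'` is obtained from `P` by the flip exchanging the contact at box `b` with the
crossing at box `b'` (a contact and a crossing between the same two pipes). -/
def IsFlip (P P' : PipeDream n) (b b' : ℕ × ℕ) : Prop :=
  b ≠ b' ∧
  P.cross b.1 b.2 = false ∧ P.cross b'.1 b'.2 = true ∧
  P'.cross b.1 b.2 = true ∧ P'.cross b'.1 b'.2 = false ∧
  (∀ r c : ℕ, (r, c) ≠ b → (r, c) ≠ b' → P.cross r c = P'.cross r c) ∧
  ((P.west b.1 b.2 = P.west b'.1 b'.2 ∧ P.south b.1 b.2 = P.south b'.1 b'.2) ∨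
    (P.west b.1 b.2 = P.south b'.1 b'.2 ∧ P.south b.1 b.2 = P.west b'.1 b'.2))

/-- There is an increasing flip from `P` to `P'`: a flip exchanging a contact at a
box `b` weakly southwest of the box `b'` of the corresponding crossing. -/
def IncFlip (P P' : PipeDream n) : Prop :=
  ∃ b b' : ℕ × ℕ, P.IsFlip P' b b' ∧ b'.1 ≤ b.1 ∧ b.2 ≤ b'.2

end PipeDream

/-- The weak order on permutations of `Fin n` : `π ≤ σ` if and only if
`Inv(π) ⊆ Inv(σ)`, where `Inv(π)` is the set of pairs `(i, j)` with `i < j` and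
`π⁻¹ i > π⁻¹ j`. -/
def WeakLE {n : ℕ} (π σ : Equiv.Perm (Fin n)) : Prop :=
  ∀ i j : Fin n, i < j → π⁻¹ j < π⁻¹ i → σ⁻¹ j < σ⁻¹ i

/-- Two permutations of `[e, ω]` are equivalent for the pipe dream congruence `≡_ω`
if they are linear extensions of the same acyclic pipe dream of `Π(ω)`. -/
def PDEquiv {n : ℕ} (ω : Equiv.Perm (Fin n)) (a b : Equiv.Perm (Fin n)) : Prop :=
  ∃ P : PipeDream n,
    P.Reduced ∧ P.HasExitPerm ω ∧ P.Acyclic ∧ P.LinExt a ∧ P.LinExt b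

namespace PipeDream

variable {n : ℕ}

/-- The pipe leaving box `(r, t)` to the north. -/
def north (P : PipeDream n) (r t : ℕ) : ℕ :=
  if P.cross r t then P.south r t else P.west r t

theorem west_zero (P : PipeDream n) (r : ℕ) : P.west r 0 = r := by
  unfold west
  rw [pipes]
  simp

theorem west_succ (P : PipeDream n) (r t : ℕ) :
    P.west r (t + 1) = if P.cross r t then P.west r t else P.south r t := by
  unfold west south
  rw [pipes]
  simp

theorem south_eq (P : PipeDream n) (r t : ℕ) (h : r + t + 2 ≤ n) :
    P.south r t = P.north (r + 1) t := by
  unfold north west south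
  rw [pipes]
  simp [h]

theorem exitPipe_eq (P : PipeDream n) (t : ℕ) : P.exitPipe t = P.north 0 t := rfl

theorem north_spec (P : PipeDream n) (t : ℕ) : ∀ m r : ℕ, r + t + 1 + m = n →
    ∃ q, r ≤ q ∧ q + t + 1 ≤ n ∧ P.cross q t = false ∧ P.north r t = P.west q t ∧
      ∀ r', r ≤ r' → r' < q → P.cross r' t = true ∧ P.south r' t = P.west q t := by
  intro m
  induction m with
  | zero =>
    intro r h
    have hc : P.cross r t = false := by
      by_contra hc
      have := P.inShape r t (by simpa using hc)
      omega
    refine ⟨r, le_rfl, by omega, hc, by simp [north, hc], ?_⟩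
    intro r' h1 h2
    omega
  | succ m ih =>
    intro r h
    cases hc : P.cross r t with
    | false =>
      refine ⟨r, le_rfl, by omega, hc, by simp [north, hc], ?_⟩
      intro r' h1 h2
      omega
    | true =>
      obtain ⟨q, h1, h2, h3, h4, h5⟩ := ih (r + 1) (by omega)
      have hs := P.south_eq r t (by omega)
      refine ⟨q, by omega, h2, h3, by rw [← h4, ← hs]; simp [north, hc], ?_⟩
      intro r' h6 h7
      rcases Nat.eq_or_lt_of_le h6 with h8 | h8
      · subst h8
        exact ⟨hc, by rw [hs, h4]⟩
      · exact h5 r' h8 h7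

theorem north_spec' (P : PipeDream n) (r t : ℕ) (h : r + t + 1 ≤ n) :
    ∃ q, r ≤ q ∧ q + t + 1 ≤ n ∧ P.cross q t = false ∧ P.north r t = P.west q t ∧
      ∀ r', r ≤ r' → r' < q → P.cross r' t = true ∧ P.south r' t = P.west q t :=
  P.north_spec t (n - (r + t + 1)) r (by omega)

theorem south_spec (P : PipeDream n) (r t : ℕ) (h : r + t + 2 ≤ n) :
    ∃ q, r < q ∧ q + t + 1 ≤ n ∧ P.cross q t = false ∧ P.south r t = P.west q t ∧
      ∀ r', r < r' → r' < q → P.cross r' t = true ∧ P.south r' t = P.west q t := by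
  obtain ⟨q, h1, h2, h3, h4, h5⟩ := P.north_spec' (r + 1) t (by omega)
  exact ⟨q, h1, h2, h3, by rw [P.south_eq r t h, h4], h5⟩

/-- Pipe `u` enters column `t` above pipe `v`. -/
def Above (P : PipeDream n) (t u v : ℕ) : Prop :=
  ∃ a b, a < b ∧ b + t + 1 ≤ n ∧ P.west a t = u ∧ P.west b t = v

/-- Pipe `u` enters column `t`. -/
def Alive (P : PipeDream n) (t u : ℕ) : Prop := ∃ a, a + t + 1 ≤ n ∧ P.west a t = u

/-- The pipes `w` and `s` cross in column `t`, with `w` coming from the west. -/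
def CrossAt (P : PipeDream n) (t w s : ℕ) : Prop :=
  ∃ b, P.cross b t = true ∧ P.west b t = w ∧ P.south b t = s

theorem above_box (P : PipeDream n) (r t : ℕ) (h : r + t + 2 ≤ n) :
    P.Above t (P.west r t) (P.south r t) := by
  obtain ⟨q, h1, h2, h3, h4, h5⟩ := P.south_spec r t h
  exact ⟨r, q, h1, h2, rfl, h4.symm⟩

theorem CrossAt.above {P : PipeDream n} {t w s : ℕ} (h : P.CrossAt t w s) : P.Above t w s := by
  obtain ⟨b, h1, rfl, rfl⟩ := h
  exact P.above_box b t (P.inShape b t h1)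

theorem above_back (P : PipeDream n) {t x y : ℕ} (h : P.Above (t + 1) x y) :
    P.Above t x y ∨ P.CrossAt t y x := by
  obtain ⟨a, b, hab, hb, hx, hy⟩ := h
  rw [P.west_succ] at hx hy
  obtain ⟨qa, a1, a2, a3, a4, a5⟩ := P.south_spec a t (by omega)
  obtain ⟨qb, b1, b2, b3, b4, b5⟩ := P.south_spec b t (by omega)
  cases hca : P.cross a t <;> cases hcb : P.cross b t <;> simp [hca, hcb] at hx hy
  · left
    refine ⟨qa, qb, ?_, b2, by rw [← a4, hx], by rw [← b4, hy]⟩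
    by_contra hlt
    have := (a5 b hab (by omega)).1
    simp [hcb] at this
  · by_cases hq : qa < b
    · left
      exact ⟨qa, b, hq, by omega, by rw [← a4, hx], hy⟩
    · right
      have : b ≠ qa := by
        rintro rfl
        simp [hcb] at a3
      refine ⟨b, hcb, hy, ?_⟩
      rw [(a5 b hab (by omega)).2, ← a4, hx]
  · left
    exact ⟨a, qb, by omega, b2, hx, by rw [← b4, hy]⟩
  · left
    exact ⟨a, b, hab, by omega, hx, hy⟩

theorem above_irrefl (P : PipeDream n) : ∀ t x : ℕ, ¬ P.Above t x x := by
  intro t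
  induction t with
  | zero =>
    rintro x ⟨a, b, h1, h2, h3, h4⟩
    rw [west_zero] at h3 h4
    omega
  | succ t ih =>
    intro x h
    rcases P.above_back h with h | h
    · exact ih x h
    · exact ih x h.above

theorem west_inj (P : PipeDream n) {t a b : ℕ} (ha : a + t + 1 ≤ n) (hb : b + t + 1 ≤ n)
    (h : P.west a t = P.west b t) : a = b := by
  rcases lt_trichotomy a b with hl | hl | hl
  · exact (P.above_irrefl t _ ⟨a, b, hl, hb, h, rfl⟩).elim
  · exact hl
  · exact (P.above_irrefl t _ ⟨b, a, hl, ha, rfl, h⟩).elim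

theorem above_asymm (P : PipeDream n) {t u v : ℕ} (h : P.Above t u v) : ¬ P.Above t v u := by
  rintro ⟨a', b', h1', h2', h3', h4'⟩
  obtain ⟨a, b, h1, h2, h3, h4⟩ := h
  have e1 := P.west_inj (t := t) (a := a) (b := b') (by omega) (by omega) (by rw [h3, h4'])
  have e2 := P.west_inj (t := t) (a := a') (b := b) (by omega) (by omega) (by rw [h4, h3'])
  omega

theorem Above.left {P : PipeDream n} {t u v : ℕ} (h : P.Above t u v) : P.Alive t u := by
  obtain ⟨a, b, h1, h2, h3, h4⟩ := h
  exact ⟨a, by omega, h3⟩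

theorem Above.right {P : PipeDream n} {t u v : ℕ} (h : P.Above t u v) : P.Alive t v := by
  obtain ⟨a, b, h1, h2, h3, h4⟩ := h
  exact ⟨b, by omega, h4⟩

theorem above_total (P : PipeDream n) {t u v : ℕ} (hu : P.Alive t u) (hv : P.Alive t v)
    (h : u ≠ v) : P.Above t u v ∨ P.Above t v u := by
  obtain ⟨a, ha, rfl⟩ := hu
  obtain ⟨b, hb, rfl⟩ := hv
  rcases lt_trichotomy a b with hl | hl | hl
  · exact Or.inl ⟨a, b, hl, hb, rfl, rfl⟩
  · subst hl
    exact (h rfl).elim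
  · exact Or.inr ⟨b, a, hl, ha, rfl, rfl⟩

theorem north_fate (P : PipeDream n) (t : ℕ) : ∀ r u : ℕ, r + t + 1 ≤ n → P.north r t = u →
    P.exitPipe t = u ∨ ∃ a, a < r ∧ P.west a (t + 1) = u := by
  intro r
  induction r with
  | zero =>
    intro u h1 h2
    exact Or.inl h2
  | succ r ih =>
    intro u h1 h2
    rw [← P.south_eq r t (by omega)] at h2
    cases hc : P.cross r t with
    | false =>
      right
      exact ⟨r, by omega, by simp [west_succ, hc, h2]⟩
    | true =>
      rcases ih u (by omega) (by simp [north, hc, h2]) with h | ⟨a, h3, h4⟩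
      · exact Or.inl h
      · exact Or.inr ⟨a, by omega, h4⟩

theorem alive_succ (P : PipeDream n) {t u : ℕ} (h : P.Alive t u) :
    P.exitPipe t = u ∨ P.Alive (t + 1) u := by
  obtain ⟨a, ha, hu⟩ := h
  cases hc : P.cross a t with
  | true =>
    right
    have := P.inShape a t hc
    exact ⟨a, by omega, by simp [west_succ, hc, hu]⟩
  | false =>
    rcases P.north_fate t a u ha (by simp [north, hc, hu]) with h | ⟨b, h1, h2⟩
    · exact Or.inl h
    · exact Or.inr ⟨b, by omega, h2⟩

theorem alive_back (P : PipeDream n) {t u : ℕ} (h : P.Alive (t + 1) u) : P.Alive t u := by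
  obtain ⟨a, ha, hu⟩ := h
  rw [west_succ] at hu
  cases hc : P.cross a t <;> simp [hc] at hu
  · obtain ⟨q, h1, h2, h3, h4, h5⟩ := P.south_spec a t (by omega)
    exact ⟨q, h2, by rw [← h4, hu]⟩
  · exact ⟨a, by omega, hu⟩

theorem alive_mono (P : PipeDream n) {s t u : ℕ} (hst : s ≤ t) (h : P.Alive t u) :
    P.Alive s u := by
  induction hst with
  | refl => exact h
  | step _ ih => exact ih (P.alive_back h)

theorem alive_lt (P : PipeDream n) {t u : ℕ} (h : P.Alive t u) : u < n := by
  obtain ⟨a, ha, hu⟩ := P.alive_mono (Nat.zero_le t) h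
  rw [west_zero] at hu
  omega

theorem exit_spec (P : PipeDream n) {t : ℕ} (ht : t < n) :
    ∃ q, q + t + 1 ≤ n ∧ P.cross q t = false ∧ P.west q t = P.exitPipe t ∧
      ∀ r, r < q → P.cross r t = true ∧ P.south r t = P.exitPipe t := by
  obtain ⟨q, h1, h2, h3, h4, h5⟩ := P.north_spec' 0 t (by omega)
  refine ⟨q, h2, h3, by rw [exitPipe_eq, h4], ?_⟩
  intro r hr
  rw [exitPipe_eq, h4]
  exact h5 r (by omega) hr

theorem exit_alive (P : PipeDream n) {t : ℕ} (ht : t < n) : P.Alive t (P.exitPipe t) := by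
  obtain ⟨q, h1, h2, h3, h4⟩ := P.exit_spec ht
  exact ⟨q, h1, h3⟩

theorem exit_not_alive (P : PipeDream n) {t : ℕ} : ¬ P.Alive (t + 1) (P.exitPipe t) := by
  rintro ⟨a, ha, hu⟩
  obtain ⟨q, h1, h2, h3, h4⟩ := P.exit_spec (t := t) (by omega)
  rw [west_succ, ← h3] at hu
  cases hc : P.cross a t <;> simp [hc] at hu
  · obtain ⟨q', g1, g2, g3, g4, g5⟩ := P.south_spec a t (by omega)
    rw [g4] at hu
    have := P.west_inj g2 h1 hu
    subst this
    have := (h4 a g1).1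
    simp [hc] at this
  · have := P.west_inj (by omega) h1 hu
    subst this
    simp [hc] at h2

theorem exit_above (P : PipeDream n) {t v : ℕ} (h : P.Above t v (P.exitPipe t)) :
    P.CrossAt t v (P.exitPipe t) := by
  obtain ⟨a, b, h1, h2, h3, h4⟩ := h
  obtain ⟨q, g1, g2, g3, g4⟩ := P.exit_spec (t := t) (by omega)
  have := P.west_inj h2 g1 (by rw [h4, g3])
  subst this
  exact ⟨a, (g4 a h1).1, h3, (g4 a h1).2⟩

theorem cross_fate (P : PipeDream n) {t w s : ℕ} (h : P.CrossAt t w s) :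
    P.Alive (t + 1) w ∧ (P.exitPipe t = s ∨ P.Above (t + 1) s w) := by
  obtain ⟨b, hc, hw, hs⟩ := h
  have hb := P.inShape b t hc
  have hw' : P.west b (t + 1) = w := by simp [west_succ, hc, hw]
  refine ⟨⟨b, by omega, hw'⟩, ?_⟩
  rcases P.north_fate t b s (by omega) (by simp [north, hc, hs]) with h | ⟨a, h1, h2⟩
  · exact Or.inl h
  · exact Or.inr ⟨a, b, h1, by omega, h2, hw'⟩

theorem above_forward (P : PipeDream n) {t u v : ℕ} (h : P.Above t u v)
    (hu : P.Alive (t + 1) u) (hv : P.Alive (t + 1) v) :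
    P.Above (t + 1) u v ∨ (P.CrossAt t u v ∧ P.Above (t + 1) v u) := by
  have hne : u ≠ v := by
    rintro rfl
    exact P.above_irrefl _ _ h
  rcases P.above_total hu hv hne with h1 | h1
  · exact Or.inl h1
  · rcases P.above_back h1 with h2 | h2
    · exact (P.above_asymm h h2).elim
    · exact Or.inr ⟨h2, h1⟩

/-- If `u` starts above `v` and `v` is above `u` later, they have crossed in between. -/
theorem crossed_between (P : PipeDream n) {s t u v : ℕ} (hst : s ≤ t) (h1 : P.Above s u v)
    (h2 : P.Above t v u) : ∃ t', s ≤ t' ∧ t' < t ∧ P.CrossAt t' u v := by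
  induction hst with
  | refl => exact (P.above_asymm h1 h2).elim
  | step hle ih =>
    rcases P.above_back h2 with h | h
    · obtain ⟨t', h3, h4, h5⟩ := ih h
      exact ⟨t', h3, by omega, h5⟩
    · exact ⟨_, hle, by omega, h⟩

/-- `c` is the exit column function of `P`. -/
structure Exits (P : PipeDream n) (c : ℕ → ℕ) : Prop where
  lt : ∀ u, u < n → c u < n
  exit_col : ∀ u, u < n → P.exitPipe (c u) = u
  col_exit : ∀ t, t < n → c (P.exitPipe t) = t

theorem Exits.alive_iff {P : PipeDream n} {c : ℕ → ℕ} (hc : P.Exits c) (t u : ℕ) :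
    P.Alive t u ↔ u < n ∧ t ≤ c u := by
  constructor
  · intro h
    have hu := P.alive_lt h
    refine ⟨hu, ?_⟩
    by_contra hlt
    have h1 := P.alive_mono (s := c u + 1) (by omega) h
    have h2 := hc.exit_col u hu
    exact P.exit_not_alive (t := c u) (by rw [h2]; exact h1)
  · rintro ⟨hu, ht⟩
    induction t with
    | zero => exact ⟨u, by omega, P.west_zero u⟩
    | succ t ih =>
      rcases P.alive_succ (ih (by omega)) with h | h
      · have := hc.col_exit t (by have := hc.lt u hu; omega)
        rw [h] at this
        omega
      · exact h

end PipeDream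
namespace PipeDream

variable {n : ℕ}

theorem Exits.must_cross {P : PipeDream n} {c : ℕ → ℕ} (hc : P.Exits c) {u v : ℕ} (m : ℕ) :
    ∀ t, c u - t = m → P.Above t v u → c u < c v → ∃ t', t ≤ t' ∧ P.CrossAt t' v u := by
  induction m with
  | zero =>
    intro t hm h huv
    have h1 := (hc.alive_iff t u).1 h.right
    have h2 : c u = t := by omega
    have h3 := hc.exit_col u h1.1
    rw [h2] at h3
    refine ⟨t, le_rfl, ?_⟩
    have h4 := P.exit_above (t := t) (v := v) (by rw [h3]; exact h)
    rw [h3] at h4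
    exact h4
  | succ m ih =>
    intro t hm h huv
    have h1 := (hc.alive_iff t u).1 h.right
    have h2 := (hc.alive_iff t v).1 h.left
    rcases P.above_forward h ((hc.alive_iff _ _).2 ⟨h2.1, by omega⟩)
      ((hc.alive_iff _ _).2 ⟨h1.1, by omega⟩) with h3 | h3
    · obtain ⟨t', h4, h5⟩ := ih (t + 1) (by omega) h3 huv
      exact ⟨t', by omega, h5⟩
    · exact ⟨t, le_rfl, h3.1⟩

theorem Exits.col_inj {P : PipeDream n} {c : ℕ → ℕ} (hc : P.Exits c) {u v : ℕ} (hu : u < n)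
    (hv : v < n) (h : c u = c v) : u = v := by
  rw [← hc.exit_col u hu, ← hc.exit_col v hv, h]

theorem Reduced.no_two {P : PipeDream n} (hr : P.Reduced) {t t' u v : ℕ}
    (h : P.CrossAt t u v) (h' : P.CrossAt t' u v ∨ P.CrossAt t' v u) : t = t' := by
  by_contra hne
  obtain ⟨b, h1, h2, h3⟩ := h
  rcases h' with ⟨b', h1', h2', h3'⟩ | ⟨b', h1', h2', h3'⟩
  · exact hr b t b' t' h1 h1' (by simp [hne]) (Or.inl ⟨by rw [h2, h2'], by rw [h3, h3']⟩)
  · exact hr b t b' t' h1 h1' (by simp [hne]) (Or.inr ⟨by rw [h2, h3'], by rw [h3, h2']⟩)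

theorem Exits.cross_col {P : PipeDream n} {c : ℕ → ℕ} (hc : P.Exits c) (hr : P.Reduced)
    {t w s : ℕ} (h : P.CrossAt t w s) : c s < c w := by
  obtain ⟨h1, h2⟩ := P.cross_fate h
  have hw := (hc.alive_iff _ _).1 h1
  have hs := (hc.alive_iff _ _).1 h.above.right
  rcases h2 with h2 | h2
  · have := hc.col_exit t (by have := hc.lt w hw.1; omega)
    rw [h2] at this
    omega
  · by_contra hlt
    have hne : c w ≠ c s := by
      intro he
      have := hc.col_inj hw.1 hs.1 he
      subst this
      exact P.above_irrefl _ _ h2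
    obtain ⟨t', h3, h4⟩ := hc.must_cross _ (t + 1) rfl h2 (by omega)
    have := hr.no_two h (Or.inr h4)
    omega

theorem Exits.reduced_of {P : PipeDream n} {c : ℕ → ℕ} (hc : P.Exits c)
    (h : ∀ t w s, P.CrossAt t w s → c s < c w) : P.Reduced := by
  have key : ∀ t t' w s, t < t' → P.CrossAt t w s → P.CrossAt t' w s → False := by
    intro t t' w s htt h1 h2
    have hs := (hc.alive_iff _ _).1 h2.above.right
    obtain ⟨h3, h4⟩ := P.cross_fate h1
    rcases h4 with h4 | h4
    · have := hc.col_exit t (by have := hc.lt s hs.1; omega)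
      rw [h4] at this
      omega
    · obtain ⟨t'', h5, h6, h7⟩ := P.crossed_between (by omega) h4 h2.above
      have g1 := h _ _ _ h7
      have g2 := h _ _ _ h1
      omega
  intro r t r' t' h1 h1' hne hcase
  rcases hcase with ⟨h2, h3⟩ | ⟨h2, h3⟩
  · rcases lt_trichotomy t t' with hl | hl | hl
    · exact key t t' _ _ hl ⟨r, h1, rfl, rfl⟩ ⟨r', h1', h2.symm, h3.symm⟩
    · subst hl
      have g1 := P.inShape _ _ h1
      have g2 := P.inShape _ _ h1'
      have := P.west_inj (by omega) (by omega) h2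
      subst this
      exact hne rfl
    · exact key t' t _ _ hl ⟨r', h1', rfl, rfl⟩ ⟨r, h1, h2, h3⟩
  · have g1 := h t _ _ ⟨r, h1, rfl, rfl⟩
    have g2 := h t' _ _ ⟨r', h1', rfl, rfl⟩
    rw [h2, h3] at g1
    omega

theorem Exits.path {P : PipeDream n} {c : ℕ → ℕ} (hc : P.Exits c) (hr : P.Reduced) (m : ℕ) :
    ∀ t u v, n - t = m → P.Above t u v → c u < c v → P.Path u v := by
  induction m with
  | zero =>
    intro t u v hm h huv
    obtain ⟨a, b, h1, h2, -⟩ := h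
    omega
  | succ m ih =>
    intro t u v hm h huv
    have hu := (hc.alive_iff _ _).1 h.left
    have hv := (hc.alive_iff _ _).1 h.right
    by_cases hut : c u = t
    · have hex := hc.exit_col u hu.1
      rw [hut] at hex
      obtain ⟨q, g1, g2, g3, g4⟩ := P.exit_spec (t := t) (by omega)
      rw [hex] at g3 g4
      have hpath : ∀ r, q ≤ r → r + t + 1 ≤ n → P.Path u (P.north r t) := by
        intro r hqr
        induction hqr with
        | refl =>
          intro _
          have : P.north q t = u := by simp [north, g2, g3]
          rw [this]
          exact Relation.ReflTransGen.refl
        | step hle ih' =>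
          rename_i r
          intro hr'
          have h1 := ih' (by omega)
          rw [← P.south_eq r t (by omega)]
          cases hcr : P.cross r t with
          | true => simpa [north, hcr] using h1
          | false =>
            refine Relation.ReflTransGen.tail (b := P.west r t) (by have h2 : P.Path u (P.west r t) := by simpa [north, hcr] using h1
                                                                    exact h2) ?_
            exact ⟨r, t, by omega, hcr, rfl, rfl⟩
      obtain ⟨a, b, h1, h2, h3, h4⟩ := h
      have haq := P.west_inj (by omega) g1 (h3.trans g3.symm)
      subst haq
      have hpb := hpath b h1.le h2
      cases hcb : P.cross b t with
      | false => simpa [north, hcb, h4] using hpb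
      | true =>
        have hcr : P.CrossAt t v (P.south b t) := ⟨b, hcb, h4, rfl⟩
        have hpb' : P.Path u (P.south b t) := by simpa [north, hcb] using hpb
        have hlt := hc.cross_col hr hcr
        rcases (P.cross_fate hcr).2 with h5 | h5
        · rw [hex] at h5
          rw [← h5] at hcr
          exact (P.above_asymm hcr.above ⟨a, b, h1, h2, h3, h4⟩).elim
        · exact Relation.ReflTransGen.trans hpb' (ih (t + 1) _ _ (by omega) h5 hlt)
    · rcases P.above_forward h ((hc.alive_iff _ _).2 ⟨hu.1, by omega⟩)
        ((hc.alive_iff _ _).2 ⟨hv.1, by omega⟩) with h3 | h3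
      · exact ih (t + 1) u v (by have := hc.lt u hu.1; omega) h3 huv
      · have := hc.cross_col hr h3.1
        omega

/-- `p` is compatible with the contact graph. -/
def Compat (P : PipeDream n) (p : ℕ → ℕ) : Prop := ∀ i j, P.Arc i j → p i < p j

theorem Compat.path {P : PipeDream n} {p : ℕ → ℕ} (hp : P.Compat p) {u v : ℕ}
    (h : P.Path u v) : p u ≤ p v := by
  induction h with
  | refl => exact le_rfl
  | tail _ h ih => exact ih.trans (hp _ _ h).le

/-- The greedy rule. -/
theorem Exits.greedy {P : PipeDream n} {c p : ℕ → ℕ} (hc : P.Exits c) (hr : P.Reduced)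
    (hp : P.Compat p) (hpi : ∀ u v, u < n → v < n → p u = p v → u = v)
    {r t : ℕ} (h : r + t + 2 ≤ n) :
    P.cross r t = true ↔
      (c (P.south r t) = t ∨ p (P.south r t) < p (P.west r t)) := by
  have hab := P.above_box r t h
  constructor
  · intro hcr
    have hx : P.CrossAt t (P.west r t) (P.south r t) := ⟨r, hcr, rfl, rfl⟩
    have hlt := hc.cross_col hr hx
    rcases (P.cross_fate hx).2 with h1 | h1
    · left
      rw [← h1]
      exact hc.col_exit t (by omega)
    · right
      have h2 := hp.path (hc.path hr _ _ _ _ rfl h1 hlt)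
      refine lt_of_le_of_ne h2 ?_
      intro he
      have := hpi _ _ (P.alive_lt hab.right) (P.alive_lt hab.left) he
      rw [this] at hab
      exact P.above_irrefl _ _ hab
  · intro hcase
    by_contra hcr
    have hcr : P.cross r t = false := by simpa using hcr
    rcases hcase with h1 | h1
    · have h2 := hc.exit_col _ (P.alive_lt hab.right)
      rw [h1] at h2
      have h3 : P.west r (t + 1) = P.south r t := by simp [west_succ, hcr]
      refine P.exit_not_alive (t := t) ?_
      rw [h2]
      exact ⟨r, by omega, h3⟩
    · have := hp _ _ ⟨r, t, h, hcr, rfl, rfl⟩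
      omega

theorem pipes_ext {P Q : PipeDream n}
    (h : ∀ r t, r + t + 2 ≤ n → P.west r t = Q.west r t → P.south r t = Q.south r t →
      P.cross r t = Q.cross r t) :
    P = Q := by
  have key : ∀ m r t, (n - r) + t = m → r + t + 1 ≤ n →
      P.west r t = Q.west r t ∧ (r + t + 2 ≤ n → P.south r t = Q.south r t) ∧
        P.cross r t = Q.cross r t := by
    intro m
    induction m using Nat.strong_induction_on with
    | _ m ih =>
      intro r t hm hn
      have hw : P.west r t = Q.west r t := by
        cases t with
        | zero => rw [west_zero, west_zero]
        | succ t =>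
          obtain ⟨h1, h2, h3⟩ := ih _ (by omega) r t rfl (by omega)
          rw [west_succ, west_succ, h1, h2 (by omega), h3]
      have hs : r + t + 2 ≤ n → P.south r t = Q.south r t := by
        intro hn2
        obtain ⟨h1, h2, h3⟩ := ih _ (by omega) (r + 1) t rfl (by omega)
        rw [south_eq _ _ _ hn2, south_eq _ _ _ hn2, north, north, h1, h3]
        cases hcq : Q.cross (r + 1) t with
        | false => simp
        | true =>
          have := Q.inShape _ _ hcq
          simp [h2 this]
      refine ⟨hw, hs, ?_⟩
      by_cases hn2 : r + t + 2 ≤ n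
      · exact h r t hn2 hw (hs hn2)
      · have h1 := P.inShape r t
        have h2 := Q.inShape r t
        cases h3 : P.cross r t <;> cases h4 : Q.cross r t <;> simp_all
  have hcr : P.cross = Q.cross := by
    funext r t
    by_cases hn : r + t + 1 ≤ n
    · exact (key _ r t rfl hn).2.2
    · have h1 := P.inShape r t
      have h2 := Q.inShape r t
      cases h3 : P.cross r t <;> cases h4 : Q.cross r t <;> simp_all <;> omega
  cases P
  cases Q
  simp_all

theorem Exits.unique {P Q : PipeDream n} {c p : ℕ → ℕ} (hc : P.Exits c) (hr : P.Reduced)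
    (hp : P.Compat p) (hpi : ∀ u v, u < n → v < n → p u = p v → u = v)
    (hc' : Q.Exits c) (hr' : Q.Reduced) (hp' : Q.Compat p) : P = Q := by
  apply pipes_ext
  intro r t h hw hs
  have h1 := hc.greedy hr hp hpi h
  have h2 := hc'.greedy hr' hp' hpi h
  rw [hw, hs] at h1
  rw [Bool.eq_iff_iff, h1, h2]

/-! Existence -/

/-- The pipes of the greedy pipe dream. -/
def gpipes (n : ℕ) (c p : ℕ → ℕ) : ℕ → ℕ → ℕ × ℕ
  | r, t =>
    (if ht : t = 0 then r
      else
        if c (gpipes n c p r (t - 1)).2 = t - 1 ∨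
            p (gpipes n c p r (t - 1)).2 < p (gpipes n c p r (t - 1)).1 then
          if r + (t - 1) + 2 ≤ n then
            (gpipes n c p r (t - 1)).1
          else (gpipes n c p r (t - 1)).2
        else (gpipes n c p r (t - 1)).2,
     if hr : r + t + 2 ≤ n then
        if c (gpipes n c p (r + 1) t).2 = t ∨
            p (gpipes n c p (r + 1) t).2 < p (gpipes n c p (r + 1) t).1 then
          if r + 1 + t + 2 ≤ n then
            (gpipes n c p (r + 1) t).2
          else (gpipes n c p (r + 1) t).1
        else (gpipes n c p (r + 1) t).1
      else 0)
  termination_by r t => (n - r) + t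
  decreasing_by all_goals omega

/-- The greedy pipe dream. -/
def greedyPD (n : ℕ) (c p : ℕ → ℕ) : PipeDream n where
  cross r t := decide (r + t + 2 ≤ n ∧ (c (gpipes n c p r t).2 = t ∨
      p (gpipes n c p r t).2 < p (gpipes n c p r t).1))
  inShape := by
    intro r t h
    simp at h
    exact h.1

theorem greedyPD_cross_def (c p : ℕ → ℕ) (r t : ℕ) :
    (greedyPD n c p).cross r t = decide (r + t + 2 ≤ n ∧ (c (gpipes n c p r t).2 = t ∨
      p (gpipes n c p r t).2 < p (gpipes n c p r t).1)) := rfl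

theorem greedyPD_pipes (c p : ℕ → ℕ) (m : ℕ) : ∀ r t, (n - r) + t = m →
    (greedyPD n c p).pipes r t = gpipes n c p r t := by
  induction m using Nat.strong_induction_on with
  | _ m ih =>
    intro r t hm
    rw [pipes, gpipes]
    refine Prod.ext ?_ ?_
    · by_cases ht : t = 0
      · simp [ht]
      · have h := ih _ (by omega) r (t - 1) rfl
        simp only [ht, h, greedyPD_cross_def]
        by_cases h1 : r + (t - 1) + 2 ≤ n <;> simp [h1]
    · by_cases hn : r + t + 2 ≤ n
      · have h := ih _ (by omega) (r + 1) t rfl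
        simp only [hn, h, greedyPD_cross_def]
        by_cases h1 : r + 1 + t + 2 ≤ n <;> simp [h1]
      · simp [hn]

theorem greedyPD_cross (c p : ℕ → ℕ) {r t : ℕ} (h : r + t + 2 ≤ n) :
    (greedyPD n c p).cross r t = true ↔ (c ((greedyPD n c p).south r t) = t ∨
      p ((greedyPD n c p).south r t) < p ((greedyPD n c p).west r t)) := by
  unfold west south
  rw [greedyPD_pipes c p _ r t rfl]
  simp [greedyPD, h]

theorem exists_greedy {c p : ℕ → ℕ} (hclt : ∀ u, u < n → c u < n)
    (hci : ∀ u v, u < n → v < n → c u = c v → u = v)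
    (hcs : ∀ t, t < n → ∃ u, u < n ∧ c u = t)
    (hpi : ∀ u v, u < n → v < n → p u = p v → u = v)
    (hle : ∀ u v, u < v → v < n → p v < p u → c v < c u) :
    ∃ P : PipeDream n, P.Exits c ∧ P.Reduced ∧ P.Compat p := by
  set P := greedyPD n c p with hP
  have hcross : ∀ r t, r + t + 2 ≤ n → (P.cross r t = true ↔ (c (P.south r t) = t ∨
      p (P.south r t) < p (P.west r t))) := fun r t h => greedyPD_cross c p h
  have hne : ∀ t u v, P.Above t u v → u ≠ v := by
    rintro t u v h rfl
    exact P.above_irrefl _ _ h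
  have inv : ∀ t, t ≤ n → (∀ u, P.Alive t u ↔ u < n ∧ t ≤ c u) ∧
      (∀ u v, P.Above t u v → u < v ∨ p u < p v) ∧
      (∀ t', t' < t → c (P.exitPipe t') = t') := by
    intro t
    induction t with
    | zero =>
      intro _
      refine ⟨?_, ?_, by intro t' h; omega⟩
      · intro u
        constructor
        · intro h
          exact ⟨P.alive_lt h, by omega⟩
        · intro h
          exact ⟨u, by omega, P.west_zero u⟩
      · rintro u v ⟨a, b, h1, h2, h3, h4⟩
        rw [west_zero] at h3 h4
        omega
    | succ t ih =>
      intro ht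
      obtain ⟨i1, i2, i3⟩ := ih (by omega)
      obtain ⟨k, hk, hkt⟩ := hcs t (by omega)
      have hexit : P.exitPipe t = k := by
        obtain ⟨q, hq, hqk⟩ := (i1 k).2 ⟨hk, hkt.ge⟩
        have hel : P.cross q t = false := by
          by_contra hcr
          have hcr : P.cross q t = true := by simpa using hcr
          have hn := P.inShape _ _ hcr
          have hab := P.above_box q t hn
          have hs := (i1 _).1 hab.right
          have hne' := hne _ _ _ hab
          rw [hqk] at hab hne'
          have h2 := (hcross q t hn).1 hcr
          rw [hqk] at h2
          have h3 : c (P.south q t) ≠ t := by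
            intro h3
            exact hne' (hci _ _ hk hs.1 (hkt.trans h3.symm))
          rcases h2 with h2 | h2
          · exact h3 h2
          · rcases i2 _ _ hab with h4 | h4
            · have := hle _ _ h4 hs.1 h2
              omega
            · omega
        have hup : ∀ r, r ≤ q → P.north (q - r) t = k := by
          intro r
          induction r with
          | zero =>
            intro _
            simp [north, hel, hqk]
          | succ r ihr =>
            intro hrq
            have h1 := ihr (by omega)
            have h2 := P.south_eq (q - (r + 1)) t (by omega)
            rw [show q - (r + 1) + 1 = q - r by omega, h1] at h2
            have h3 := (hcross (q - (r + 1)) t (by omega)).2 (by rw [h2]; exact Or.inl hkt)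
            simp [north, h3, h2]
        have := hup q le_rfl
        rw [Nat.sub_self] at this
        exact this
      have halive : ∀ u, P.Alive (t + 1) u ↔ u < n ∧ t + 1 ≤ c u := by
        intro u
        constructor
        · intro h
          obtain ⟨h1, h2⟩ := (i1 u).1 (P.alive_back h)
          refine ⟨h1, ?_⟩
          have : c u ≠ t := by
            intro h3
            have := hci _ _ h1 hk (h3.trans hkt.symm)
            subst this
            rw [← hexit] at h
            exact P.exit_not_alive h
          omega
        · rintro ⟨h1, h2⟩
          rcases P.alive_succ ((i1 u).2 ⟨h1, by omega⟩) with h | h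
          · rw [hexit] at h
            subst h
            omega
          · exact h
      refine ⟨halive, ?_, ?_⟩
      · intro u v h
        rcases P.above_back h with h1 | ⟨b, h1, h2, h3⟩
        · exact i2 _ _ h1
        · have h4 := (hcross b t (P.inShape _ _ h1)).1 h1
          rw [h2, h3] at h4
          have := ((halive u).1 h.left).2
          right
          omega
      · intro t' ht'
        rcases Nat.lt_succ_iff_lt_or_eq.1 ht' with h | h
        · exact i3 t' h
        · rw [h, hexit, hkt]
  have hcol : ∀ t, t < n → c (P.exitPipe t) = t := (inv n le_rfl).2.2
  have hexits : P.Exits c := by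
    refine ⟨hclt, ?_, hcol⟩
    intro u hu
    exact hci _ _ (P.alive_lt (P.exit_alive (hclt u hu))) hu (hcol _ (hclt u hu))
  refine ⟨P, hexits, ?_, ?_⟩
  · apply hexits.reduced_of
    intro t w s h
    have hw := (hexits.alive_iff _ _).1 (P.cross_fate h).1
    have hab := h.above
    have hs := (hexits.alive_iff _ _).1 hab.right
    obtain ⟨b, h1, h2, h3⟩ := h
    have hn := P.inShape _ _ h1
    have h4 := (hcross b t hn).1 h1
    rw [h2, h3] at h4
    rcases h4 with h4 | h4
    · omega
    · rcases (inv t (by omega)).2.1 _ _ hab with h5 | h5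
      · exact hle _ _ h5 hs.1 h4
      · omega
  · rintro i j ⟨r, t, h1, h2, h3, h4⟩
    have hab := P.above_box r t h1
    have h5 := hcross r t h1
    rw [h2, h3, h4] at h5
    rw [h3, h4] at hab
    have h6 : p i ≠ p j := fun h => hne _ _ _ hab
      (hpi _ _ (P.alive_lt hab.left) (P.alive_lt hab.right) h)
    simp at h5
    omega

end PipeDream
namespace PipeDream

variable {n : ℕ}

theorem Exits.north_min {P : PipeDream n} {c p : ℕ → ℕ} (hc : P.Exits c) (hr : P.Reduced)
    (hp : P.Compat p) (hpi : ∀ u v, u < n → v < n → p u = p v → u = v) (t m : ℕ) :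
    ∀ r, r + t + 1 + m = n → (∀ r', r ≤ r' → r' + t + 1 ≤ n → c (P.west r' t) ≠ t) →
      ∀ r', r ≤ r' → r' + t + 1 ≤ n → p (P.north r t) ≤ p (P.west r' t) := by
  induction m with
  | zero =>
    intro r h1 h2 r' h3 h4
    have : r' = r := by omega
    subst this
    have hcr : P.cross r' t = false := by
      by_contra hcr
      have := P.inShape r' t (by simpa using hcr)
      omega
    simp [north, hcr]
  | succ m ih =>
    intro r h1 h2 r' h3 h4
    have ih' := ih (r + 1) (by omega) (fun r' h => h2 r' (by omega))
    rw [← P.south_eq r t (by omega)] at ih'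
    have hg := hc.greedy hr hp hpi (r := r) (t := t) (by omega)
    obtain ⟨q, q1, q2, q3, q4, q5⟩ := P.south_spec r t (by omega)
    have hq := h2 q (by omega) q2
    rw [← q4] at hq
    cases hcr : P.cross r t with
    | true =>
      have h5 := hg.1 hcr
      simp only [north, hcr, if_true]
      rcases Nat.eq_or_lt_of_le h3 with h6 | h6
      · subst h6
        omega
      · exact ih' r' h6 h4
    | false =>
      have h5 : p (P.west r t) < p (P.south r t) := hp _ _ ⟨r, t, by omega, hcr, rfl, rfl⟩
      simp only [north, hcr]
      rcases Nat.eq_or_lt_of_le h3 with h6 | h6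
      · subst h6
        exact le_rfl
      · exact h5.le.trans (ih' r' h6 h4)

theorem row_west {P : PipeDream n} {i T : ℕ} (h : ∀ t, t < T → P.cross i t = true) :
    ∀ t, t ≤ T → P.west i t = i := by
  intro t
  induction t with
  | zero =>
    intro _
    exact P.west_zero i
  | succ t ih =>
    intro ht
    simp [west_succ, h t (by omega), ih (by omega)]

theorem row_cross {P : PipeDream n} {i T : ℕ} (h : ∀ t, t < T → P.cross i t = true)
    {t u : ℕ} (ht : t < T) (hu : P.CrossAt t i u) : P.south i t = u := by
  obtain ⟨b, h1, h2, h3⟩ := hu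
  have h4 := P.inShape _ _ h1
  have h5 := P.inShape _ _ (h t ht)
  have := P.west_inj (a := b) (b := i) (t := t) (by omega) (by omega)
    (by rw [h2, row_west h t ht.le])
  rw [← this]
  rw [this] at h3
  rw [← h3, this]

/-- The set of pipes crossing pipe `i` in its initial row. -/
def rowSet (P : PipeDream n) (i T : ℕ) : Finset ℕ := (Finset.range T).image (fun t => P.south i t)

theorem rowSet_card {P : PipeDream n} (hr : P.Reduced) {i T : ℕ}
    (h : ∀ t, t < T → P.cross i t = true) : (P.rowSet i T).card = T := by
  unfold rowSet
  rw [Finset.card_image_of_injOn, Finset.card_range]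
  intro a ha b hb hab
  simp at ha hb hab
  exact hr.no_two (u := i) (v := P.south i a) ⟨i, h a ha, row_west h a ha.le, rfl⟩
    (Or.inl ⟨i, h b hb, row_west h b hb.le, hab.symm⟩)

theorem above_zero {P : PipeDream n} {u v : ℕ} (h : u < v) (hv : v < n) : P.Above 0 u v :=
  ⟨u, v, h, by omega, P.west_zero u, P.west_zero v⟩

theorem mem_rowSet_of_above {P : PipeDream n} {i T u t : ℕ}
    (h : ∀ t, t < T → P.cross i t = true) (ht : t ≤ T) (hiu : i < u)
    (hab : P.Above t u i) : u ∈ P.rowSet i T := by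
  obtain ⟨t', h1, h2, h3⟩ := P.crossed_between (Nat.zero_le t)
    (above_zero hiu (P.alive_lt hab.left)) hab
  have := row_cross h (by omega) h3
  exact Finset.mem_image.2 ⟨t', by simp; omega, this⟩

theorem Exits.mem_rowSet_of_exit {P : PipeDream n} {c : ℕ → ℕ} (hc : P.Exits c) {i T u : ℕ}
    (h : ∀ t, t < T → P.cross i t = true) (hu : u < n) (hiu : i < u) (hcu : c u < T) :
    u ∈ P.rowSet i T := by
  have hi := P.inShape _ _ (h _ hcu)
  have hw := row_west h _ hcu.le
  have hai : P.Alive (c u) i := ⟨i, by omega, hw⟩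
  have hau : P.Alive (c u) u := (hc.alive_iff _ _).2 ⟨hu, le_rfl⟩
  rcases P.above_total hai hau (by omega) with h1 | h1
  · have h2 := hc.exit_col u hu
    have h3 := P.exit_above (t := c u) (v := i) (by rw [h2]; exact h1)
    rw [h2] at h3
    exact Finset.mem_image.2 ⟨c u, by simpa using hcu, row_cross h hcu h3⟩
  · exact mem_rowSet_of_above h hcu.le hiu h1

theorem Exits.count {P : PipeDream n} {c : ℕ → ℕ} (hc : P.Exits c) {i T : ℕ} (hT : T ≤ n)
    (hi : T ≤ c i) :
    ((Finset.range n).filter (fun u => u < i ∧ c u < T)).card +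
      ((Finset.range n).filter (fun u => i < u ∧ c u < T)).card = T := by
  have h1 : ((Finset.range n).filter (fun u => c u < T)).card = T := by
    have : (Finset.range n).filter (fun u => c u < T) = (Finset.range T).image P.exitPipe := by
      ext u
      simp only [Finset.mem_filter, Finset.mem_range, Finset.mem_image]
      constructor
      · rintro ⟨h1, h2⟩
        exact ⟨c u, h2, hc.exit_col u h1⟩
      · rintro ⟨t, h1, rfl⟩
        exact ⟨P.alive_lt (P.exit_alive (by omega)), by rw [hc.col_exit t (by omega)]; exact h1⟩
    rw [this, Finset.card_image_of_injOn, Finset.card_range]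
    intro a ha b hb hab
    simp at ha hb
    rw [← hc.col_exit a (by omega), ← hc.col_exit b (by omega), hab]
  rw [← h1, ← Finset.card_union_of_disjoint]
  · congr 1
    ext u
    simp only [Finset.mem_filter, Finset.mem_range, Finset.mem_union]
    rcases lt_trichotomy u i with h | h | h
    · omega
    · subst h
      omega
    · omega
  · rw [Finset.disjoint_left]
    intro u
    simp only [Finset.mem_filter, Finset.mem_range]
    omega

end PipeDream

/-- The set `D` of the local criterion. -/
def setD (n : ℕ) (c p : ℕ → ℕ) (i j : ℕ) : Finset ℕ :=
  (Finset.range n).filter (fun u => i < u ∧ u < j ∧ c j < c u ∧ c u < c i ∧ p u < p i)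

/-- The set `A` of the local criterion. -/
def setA (n : ℕ) (c : ℕ → ℕ) (i j : ℕ) : Finset ℕ :=
  (Finset.range n).filter (fun u => u < i ∧ c u < c j)

namespace PipeDream

variable {n : ℕ}

theorem Exits.noarc_imp {P : PipeDream n} {c p : ℕ → ℕ} (hc : P.Exits c) (hr : P.Reduced)
    (hp : P.Compat p) (hpi : ∀ u v, u < n → v < n → p u = p v → u = v)
    (hle : ∀ u v, u < v → v < n → p v < p u → c v < c u)
    {i j : ℕ} (hij : i < j) (hj : j < n) (hpij : p i < p j)
    (hadj : ∀ u, u < n → p i < p u → p j ≤ p u) (hcij : c j < c i)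
    (hno : ¬ P.Arc i j) : (setA n c i j).card ≤ (setD n c p i j).card := by
  have hcj := hc.lt j hj
  have habove : ∀ t, t ≤ c j → P.Above t i j := by
    intro t
    induction t with
    | zero =>
      intro _
      exact above_zero hij hj
    | succ t ih =>
      intro ht
      rcases P.above_forward (ih (by omega)) ((hc.alive_iff _ _).2 ⟨by omega, by omega⟩)
        ((hc.alive_iff _ _).2 ⟨by omega, by omega⟩) with h | ⟨⟨b, h1, h2, h3⟩, h4⟩
      · exact h
      · have := (hc.greedy hr hp hpi (P.inShape _ _ h1)).1 h1
        rw [h2, h3] at this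
        omega
  have hrow : ∀ T, T ≤ c j + 1 → ∀ t, t < T → P.cross i t = true := by
    intro T
    induction T with
    | zero =>
      intro _ t ht
      omega
    | succ T ih =>
      intro hT t ht
      have hT' := ih (by omega)
      rcases Nat.lt_succ_iff_lt_or_eq.1 ht with h | h
      · exact hT' t h
      subst h
      have hw := row_west hT' t le_rfl
      have hab := habove t (by omega)
      obtain ⟨a, b, h1, h2, h3, h4⟩ := hab
      have ha := P.west_inj (t := t) (a := a) (b := i) (by omega)
        (by
          by_cases h0 : t = 0
          · omega
          · have := P.inShape _ _ (hT' (t - 1) (by omega))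
            omega) (by rw [h3, hw])
      subst ha
      by_contra hcr
      have hcr : P.cross a t = false := by simpa using hcr
      have harc : P.Arc a (P.south a t) := ⟨a, t, by omega, hcr, hw, rfl⟩
      have hlt := hp _ _ harc
      have hmin := hc.north_min hr hp hpi t (n - (a + 1 + t + 1)) (a + 1) (by omega)
        (by
          intro r' h5 h6 h7
          have h8 := hc.exit_col _ (P.alive_lt ⟨r', h6, rfl⟩)
          rw [h7] at h8
          have h9 := P.exit_above (t := t) (v := a)
            ⟨a, r', by omega, h6, hw, h8.symm⟩
          obtain ⟨b', g1, g2, g3⟩ := h9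
          have := P.inShape _ _ g1
          have := P.west_inj (t := t) (a := b') (b := a) (by omega) (by omega) (by rw [g2, hw])
          subst this
          simp [hcr] at g1) b h1 h2
      rw [← P.south_eq a t (by omega), h4] at hmin
      have hsn : P.south a t < n := P.alive_lt (P.above_box a t (by omega)).right
      have h5 := hadj _ hsn hlt
      have h6 := hpi _ _ hsn hj (by omega)
      rw [h6] at harc
      exact hno harc
  have hrow' := hrow (c j + 1) le_rfl
  have hcount := hc.count (i := i) (T := c j + 1) (by omega) (by omega)
  have hX := rowSet_card hr hrow'
  have hA : (Finset.range n).filter (fun u => u < i ∧ c u < c j + 1) = setA n c i j := by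
    ext u
    simp only [setA, Finset.mem_filter, Finset.mem_range]
    constructor
    · rintro ⟨h1, h2, h3⟩
      refine ⟨h1, h2, ?_⟩
      have : c u ≠ c j := fun h => by
        have := hc.col_inj h1 hj h
        omega
      omega
    · omega
  rw [hA] at hcount
  have hsub : P.rowSet i (c j + 1) ⊆
      (Finset.range n).filter (fun u => i < u ∧ c u < c j + 1) ∪ setD n c p i j := by
    intro x hx
    obtain ⟨t, ht, rfl⟩ := Finset.mem_image.1 hx
    simp only [Finset.mem_range] at ht
    have hcr := hrow' t ht
    have hw := row_west hrow' t ht.le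
    have hx' : P.CrossAt t i (P.south i t) := ⟨i, hcr, hw, rfl⟩
    have hsn := P.alive_lt hx'.above.right
    have hclt := hc.cross_col hr hx'
    have hg := (hc.greedy hr hp hpi (P.inShape _ _ hcr)).1 hcr
    rw [hw] at hg
    generalize P.south i t = x at *
    have hix : i < x := by
      rcases lt_trichotomy i x with h | h | h
      · exact h
      · subst h
        omega
      · obtain ⟨t', h1, h2, h3⟩ := P.crossed_between (Nat.zero_le t)
          (above_zero h (by omega)) hx'.above
        have := hc.cross_col hr h3
        omega
    simp only [Finset.mem_union, setD, Finset.mem_filter, Finset.mem_range]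
    by_cases h1 : c x < c j + 1
    · left
      exact ⟨hsn, hix, h1⟩
    · right
      have h2 : p x < p i := by omega
      refine ⟨hsn, hix, ?_, by omega, hclt, h2⟩
      by_contra h3
      have h4 : x ≠ j := by
        rintro rfl
        omega
      have h5 : ¬ (p x < p j) := fun h => by
        have := hle j x (by omega) hsn h
        omega
      omega
  have h1 := Finset.card_le_card hsub
  have h2 := Finset.card_union_le
    ((Finset.range n).filter (fun u => i < u ∧ c u < c j + 1)) (setD n c p i j)
  omega

theorem Exits.imp_noarc {P : PipeDream n} {c p : ℕ → ℕ} (hc : P.Exits c) (hr : P.Reduced)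
    (hp : P.Compat p) (hpi : ∀ u v, u < n → v < n → p u = p v → u = v)
    {i j : ℕ} (hij : i < j) (hcij : c j < c i)
    (hcard : (setA n c i j).card ≤ (setD n c p i j).card) : ¬ P.Arc i j := by
  rintro ⟨r, tc, hn, hel, hwi, hsj⟩
  have habc := P.above_box r tc hn
  rw [hwi, hsj] at habc
  have hj := (hc.alive_iff _ _).1 habc.right
  have hex : ∃ t, t ≤ tc ∧ P.cross i t = false := by
    by_contra hcon
    push Not at hcon
    have hall : ∀ t, t < tc + 1 → P.cross i t = true := by
      intro t ht
      simpa using hcon t (by omega)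
    have hw := row_west hall tc (by omega)
    have := P.inShape _ _ (hall tc (by omega))
    have := P.west_inj (a := r) (b := i) (t := tc) (by omega) (by omega) (by rw [hwi, hw])
    subst this
    have := hall tc (by omega)
    simp [hel] at this
  have hspec := Nat.find_spec hex
  have hmin : ∀ t, t < Nat.find hex → P.cross i t = true := by
    intro t ht
    have := Nat.find_min hex ht
    have h2 := hspec.1
    by_contra h
    exact this ⟨by omega, by simpa using h⟩
  generalize Nat.find hex = t at hspec hmin
  obtain ⟨htc, helt⟩ := hspec
  have hw := row_west hmin t le_rfl
  have hbound : i + t + 1 ≤ n := by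
    by_cases h0 : t = 0
    · omega
    · have := P.inShape _ _ (hmin (t - 1) (by omega))
      omega
  have hai : P.Alive t i := ⟨i, hbound, hw⟩
  -- the exit pipe of column `t` is above `i`
  have hkn := P.alive_lt (P.exit_alive (t := t) (by omega))
  have hck := hc.col_exit t (by omega)
  have hki : P.exitPipe t ≠ i := by
    intro h
    rw [h] at hck
    omega
  have hkab : P.Above t (P.exitPipe t) i := by
    rcases P.above_total (P.exit_alive (by omega)) hai hki with h | h
    · exact h
    · obtain ⟨b, h1, h2, h3⟩ := P.exit_above h
      have := P.inShape _ _ h1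
      have := P.west_inj (t := t) (a := b) (b := i) (by omega) (by omega) (by rw [h2, hw])
      subst this
      simp [helt] at h1
  generalize P.exitPipe t = k at *
  have hkj : k ≠ j := by
    rintro rfl
    have : t = tc := by omega
    subst this
    exact P.above_asymm hkab habc
  have hckj : c k < c j := by
    have : c k ≠ c j := fun h => hkj (hc.col_inj hkn hj.1 h)
    omega
  -- nothing of `D` is below `i`
  have hbelow : ∀ u, P.Above t i u → p i < p u := by
    rintro u ⟨a, b, h1, h2, h3, h4⟩
    have ha := P.west_inj (t := t) (a := a) (b := i) (by omega) hbound (by rw [h3, hw])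
    subst ha
    have harc : P.Arc a (P.south a t) := ⟨a, t, by omega, helt, hw, rfl⟩
    have hlt := hp _ _ harc
    have hm := hc.north_min hr hp hpi t (n - (a + 1 + t + 1)) (a + 1) (by omega)
      (by
        intro r' h5 h6 h7
        have h8 := hc.col_inj (P.alive_lt ⟨r', h6, rfl⟩) hkn (h7.trans hck.symm)
        exact P.above_asymm hkab ⟨a, r', by omega, h6, hw, h8⟩) b h1 h2
    rw [← P.south_eq a t (by omega), h4] at hm
    omega
  have hcount := hc.count (i := i) (T := t) (by omega) (by omega)
  have hX := rowSet_card hr hmin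
  have hDX : setD n c p i j ⊆ P.rowSet i t := by
    intro u hu
    simp only [setD, Finset.mem_filter, Finset.mem_range] at hu
    obtain ⟨h1, h2, h3, h4, h5, h6⟩ := hu
    have hau : P.Alive t u := (hc.alive_iff _ _).2 ⟨h1, by omega⟩
    rcases P.above_total hai hau (by omega) with h | h
    · have := hbelow u h
      omega
    · exact mem_rowSet_of_above hmin le_rfl h2 h
  have hBX : (Finset.range n).filter (fun u => i < u ∧ c u < t) ⊆ P.rowSet i t := by
    intro u hu
    simp only [Finset.mem_filter, Finset.mem_range] at hu
    exact hc.mem_rowSet_of_exit hmin hu.1 hu.2.1 hu.2.2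
  have hdisj : Disjoint (setD n c p i j) ((Finset.range n).filter (fun u => i < u ∧ c u < t)) := by
    rw [Finset.disjoint_left]
    intro u
    simp only [setD, Finset.mem_filter, Finset.mem_range]
    omega
  have hAsub : (Finset.range n).filter (fun u => u < i ∧ c u < t) ⊆ setA n c i j := by
    intro u
    simp only [setA, Finset.mem_filter, Finset.mem_range]
    omega
  have hun := Finset.card_union_of_disjoint hdisj
  rcases lt_or_gt_of_ne hki with hlt | hgt
  · have h1 := Finset.card_le_card (Finset.union_subset hDX hBX)
    have h2 : insert k ((Finset.range n).filter (fun u => u < i ∧ c u < t)) ⊆ setA n c i j := by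
      refine Finset.insert_subset ?_ hAsub
      simp only [setA, Finset.mem_filter, Finset.mem_range]
      omega
    have h3 := Finset.card_le_card h2
    rw [Finset.card_insert_of_notMem (by simp; omega)] at h3
    omega
  · have hkX : k ∈ P.rowSet i t := mem_rowSet_of_above hmin le_rfl hgt hkab
    have h1 := Finset.card_le_card
      (Finset.insert_subset hkX (Finset.union_subset hDX hBX))
    rw [Finset.card_insert_of_notMem (by simp [setD]; omega)] at h1
    have h2 := Finset.card_le_card hAsub
    omega

end PipeDream
section AbstractLattice

theorem join_contract {L : Type*} [Lattice L] [Finite L] (step C : L → L → Prop)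
    (hstep : ∀ x y, step x y → x < y) (hCs : ∀ x y, C x y → step x y)
    (hex : ∀ x z, x < z → ∃ x1, step x x1 ∧ x1 ≤ z)
    (hpoly : ∀ x y x1, C x y → step x x1 → x1 ≠ y → Relation.ReflTransGen C x1 (x1 ⊔ y))
    (x : L) : ∀ y z, C x y → x ≤ z → Relation.EqvGen C z (z ⊔ y) := by
  induction x using (wellFounded_gt (α := L)).induction with
  | _ x ih =>
    intro y z hC hxz
    rcases eq_or_lt_of_le hxz with rfl | hlt
    · rw [sup_eq_right.2 (hstep _ _ (hCs _ _ hC)).le]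
      exact Relation.EqvGen.rel _ _ hC
    · obtain ⟨x1, h1, h2⟩ := hex x z hlt
      by_cases hy : x1 = y
      · subst hy
        rw [sup_eq_left.2 h2]
        exact Relation.EqvGen.refl _
      · have hchain := hpoly x y x1 hC h1 hy
        have key : ∀ w, Relation.ReflTransGen C x1 w →
            x < w ∧ Relation.EqvGen C z (z ⊔ w) := by
          intro w hw
          induction hw with
          | refl =>
            refine ⟨hstep _ _ h1, ?_⟩
            rw [sup_eq_left.2 h2]
            exact Relation.EqvGen.refl _
          | tail _ hbc ih' =>
            rename_i b c _
            obtain ⟨g1, g2⟩ := ih'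
            have hbc' := hstep _ _ (hCs _ _ hbc)
            refine ⟨g1.trans hbc', ?_⟩
            have g3 := ih b g1 c (z ⊔ b) hbc le_sup_right
            rw [sup_assoc, sup_eq_right.2 hbc'.le] at g3
            exact Relation.EqvGen.trans _ _ _ g2 g3
        have := (key _ hchain).2
        rw [← sup_assoc, sup_eq_left.2 h2] at this
        exact this

theorem join_cong {L : Type*} [Lattice L] [Finite L] (step C : L → L → Prop)
    (hstep : ∀ x y, step x y → x < y) (hCs : ∀ x y, C x y → step x y)
    (hex : ∀ x z, x < z → ∃ x1, step x x1 ∧ x1 ≤ z)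
    (hpoly : ∀ x y x1, C x y → step x x1 → x1 ≠ y → Relation.ReflTransGen C x1 (x1 ⊔ y))
    {x y x' y' : L} (h : Relation.EqvGen C x y) (h' : Relation.EqvGen C x' y') :
    Relation.EqvGen C (x ⊔ x') (y ⊔ y') := by
  have key : ∀ x y : L, Relation.EqvGen C x y → ∀ z, Relation.EqvGen C (x ⊔ z) (y ⊔ z) := by
    intro x y h z
    induction h with
    | rel x y h =>
      have h1 := join_contract step C hstep hCs hex hpoly x y (x ⊔ z) h le_sup_left
      have h2 : x ⊔ z ⊔ y = y ⊔ z := by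
        rw [sup_right_comm, sup_eq_right.2 (hstep _ _ (hCs _ _ h)).le]
      rwa [h2] at h1
    | refl x => exact Relation.EqvGen.refl _
    | symm x y _ ih => exact Relation.EqvGen.symm _ _ ih
    | trans x y z _ _ ih1 ih2 => exact Relation.EqvGen.trans _ _ _ ih1 ih2
  have h1 := key _ _ h x'
  have h2 := key _ _ h' y
  rw [sup_comm x' y, sup_comm y' y] at h2
  exact Relation.EqvGen.trans _ _ _ h1 h2

theorem eqvGen_swap {L : Type*} {C : L → L → Prop} {x y : L}
    (h : Relation.EqvGen C x y) : Relation.EqvGen (fun a b => C b a) x y := by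
  induction h with
  | rel x y h => exact Relation.EqvGen.symm _ _ (Relation.EqvGen.rel _ _ h)
  | refl x => exact Relation.EqvGen.refl _
  | symm x y _ ih => exact Relation.EqvGen.symm _ _ ih
  | trans x y z _ _ ih1 ih2 => exact Relation.EqvGen.trans _ _ _ ih1 ih2

theorem meet_cong {L : Type*} [Lattice L] [Finite L] (step C : L → L → Prop)
    (hstep : ∀ x y, step x y → x < y) (hCs : ∀ x y, C x y → step x y)
    (hex : ∀ x z, z < x → ∃ x1, step x1 x ∧ z ≤ x1)
    (hpoly : ∀ x y x1, C y x → step x1 x → x1 ≠ y →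
      Relation.ReflTransGen (fun a b => C b a) x1 (x1 ⊓ y))
    {x y x' y' : L} (h : Relation.EqvGen C x y) (h' : Relation.EqvGen C x' y') :
    Relation.EqvGen C (x ⊓ x') (y ⊓ y') := by
  have := join_cong (L := Lᵒᵈ) (fun a b => step b a) (fun a b => C b a)
    (fun x y h => hstep y x h) (fun x y h => hCs y x h)
    (fun x z h => hex x z h) (fun x y x1 h1 h2 h3 => hpoly x y x1 h1 h2 h3)
    (eqvGen_swap h) (eqvGen_swap h')
  exact eqvGen_swap this

end AbstractLattice

/-- Position of the value `u` in the permutation `π`, as a natural number. -/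
def pos {n : ℕ} (π : Equiv.Perm (Fin n)) (u : ℕ) : ℕ :=
  if h : u < n then (π⁻¹ ⟨u, h⟩).val else n

section Perms

variable {n : ℕ}

theorem pos_fin (π : Equiv.Perm (Fin n)) (u : Fin n) : pos π u.val = (π⁻¹ u).val := by
  simp [pos]

theorem pos_lt (π : Equiv.Perm (Fin n)) {u : ℕ} (h : u < n) : pos π u < n := by
  simp [pos, h]

theorem pos_inj (π : Equiv.Perm (Fin n)) (u v : ℕ) (hu : u < n) (hv : v < n)
    (h : pos π u = pos π v) : u = v := by
  simp only [pos, hu, hv, dif_pos] at h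
  have := π⁻¹.injective (Fin.ext h)
  simpa using this

theorem pos_surj (π : Equiv.Perm (Fin n)) (t : ℕ) (ht : t < n) : ∃ u, u < n ∧ pos π u = t := by
  refine ⟨(π ⟨t, ht⟩).val, (π ⟨t, ht⟩).isLt, ?_⟩
  rw [pos_fin]
  simp

theorem weakLE_iff {x y : Equiv.Perm (Fin n)} : WeakLE x y ↔
    ∀ a b, a < b → b < n → pos x b < pos x a → pos y b < pos y a := by
  constructor
  · intro h a b hab hb hx
    have ha : a < n := by omega
    have := h ⟨a, ha⟩ ⟨b, hb⟩ hab
    simp only [pos, ha, hb, dif_pos] at hx ⊢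
    exact this hx
  · intro h i j hij hx
    have := h i.val j.val hij j.isLt
    rw [pos_fin, pos_fin, pos_fin, pos_fin] at this
    exact this hx

theorem weakLE_trans {x y z : Equiv.Perm (Fin n)} (h1 : WeakLE x y) (h2 : WeakLE y z) :
    WeakLE x z := fun i j hij h => h2 i j hij (h1 i j hij h)

theorem weakLE_antisymm {x y : Equiv.Perm (Fin n)} (h1 : WeakLE x y) (h2 : WeakLE y x) :
    x = y := by
  have hiff : ∀ a b : Fin n, x⁻¹ a < x⁻¹ b → y⁻¹ a < y⁻¹ b := by
    intro a b h
    rcases lt_trichotomy a b with hl | hl | hl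
    · by_contra hcon
      have hne : y⁻¹ a ≠ y⁻¹ b := fun he => hl.ne (y⁻¹.injective he)
      have := h2 a b hl (lt_of_le_of_ne (not_lt.1 hcon) hne.symm)
      exact lt_asymm h this
    · subst hl
      exact (lt_irrefl _ h).elim
    · exact h1 b a hl h
  have hmono : StrictMono (fun m : Fin n => y⁻¹ (x m)) := by
    intro a b hab
    exact hiff _ _ (by simpa using hab)
  have hid : (fun m : Fin n => y⁻¹ (x m)) = id := by
    refine StrictMono.range_inj hmono strictMono_id |>.1 ?_
    rw [Set.range_id]
    exact (y⁻¹.surjective.comp x.surjective).range_eq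
  ext m
  have := congrFun hid m
  simp only [id] at this
  rw [Equiv.Perm.inv_eq_iff_eq] at this
  rw [this]

/-- `y` is obtained from `x` by exchanging the consecutive values `i < j`. -/
structure Sw (x y : Equiv.Perm (Fin n)) (i j : ℕ) : Prop where
  lt : i < j
  jn : j < n
  adj : pos x j = pos x i + 1
  yi : pos y i = pos x j
  yj : pos y j = pos x i
  other : ∀ u, u < n → u ≠ i → u ≠ j → pos y u = pos x u

theorem Sw.inv {x y : Equiv.Perm (Fin n)} {i j : ℕ} (h : Sw x y i j) {a b : ℕ} (hab : a < b)
    (hb : b < n) : pos y b < pos y a ↔ (pos x b < pos x a ∨ (a = i ∧ b = j)) := by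
  obtain ⟨h1, h2, h3, h4, h5, h6⟩ := h
  have ai := pos_inj x a i (by omega) (by omega)
  have aj := pos_inj x a j (by omega) (by omega)
  have bi := pos_inj x b i (by omega) (by omega)
  have bj := pos_inj x b j (by omega) (by omega)
  have oa := h6 a (by omega)
  have ob := h6 b hb
  by_cases e1 : a = i
  · subst e1
    by_cases e2 : b = j
    · subst e2
      omega
    · have := ob (by omega) e2
      omega
  · by_cases e3 : a = j
    · subst e3
      have := ob (by omega) (by omega)
      omega
    · have := oa e1 e3
      by_cases e2 : b = j
      · subst e2
        omega
      · by_cases e4 : b = i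
        · subst e4
          omega
        · have := ob e4 e2
          omega

theorem Sw.le {x y : Equiv.Perm (Fin n)} {i j : ℕ} (h : Sw x y i j) : WeakLE x y := by
  rw [weakLE_iff]
  intro a b hab hb hx
  exact (h.inv hab hb).2 (Or.inl hx)

theorem Sw.not_le {x y : Equiv.Perm (Fin n)} {i j : ℕ} (h : Sw x y i j) : ¬ WeakLE y x := by
  rw [weakLE_iff]
  intro hc
  have := hc i j h.lt h.jn (by have := h.adj; have := h.yi; have := h.yj; omega)
  have := h.adj
  omega

theorem pos_swap (x : Equiv.Perm (Fin n)) {a b : ℕ} (ha : a < n) (hb : b < n) :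
    ∃ y : Equiv.Perm (Fin n), pos y a = pos x b ∧ pos y b = pos x a ∧
      ∀ u, u < n → u ≠ a → u ≠ b → pos y u = pos x u := by
  refine ⟨Equiv.swap ⟨a, ha⟩ ⟨b, hb⟩ * x, ?_, ?_, ?_⟩
  · simp [pos, ha, hb]
  · simp [pos, ha, hb]
  · intro u hu h1 h2
    simp only [pos, hu, dif_pos, mul_inv_rev, Equiv.swap_inv, Equiv.Perm.mul_apply]
    rw [Equiv.swap_apply_of_ne_of_ne]
    · simpa using h1
    · simpa using h2

theorem Sw.exists_up (x : Equiv.Perm (Fin n)) {i j : ℕ} (hij : i < j) (hj : j < n)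
    (h : pos x j = pos x i + 1) : ∃ y, Sw x y i j := by
  obtain ⟨y, h1, h2, h3⟩ := pos_swap x (a := i) (b := j) (by omega) hj
  exact ⟨y, hij, hj, h, h1, h2, h3⟩

theorem Sw.exists_down (x : Equiv.Perm (Fin n)) {i j : ℕ} (hij : i < j) (hj : j < n)
    (h : pos x i = pos x j + 1) : ∃ y, Sw y x i j := by
  obtain ⟨y, h1, h2, h3⟩ := pos_swap x (a := i) (b := j) (by omega) hj
  exact ⟨y, hij, hj, by omega, by omega, by omega, fun u hu g1 g2 => (h3 u hu g1 g2).symm⟩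

theorem Sw.unique_up {x y y' : Equiv.Perm (Fin n)} {i j : ℕ} (h : Sw x y i j)
    (h' : Sw x y' i j) : y = y' := by
  apply weakLE_antisymm <;> rw [weakLE_iff] <;> intro a b hab hb
  · rw [h.inv hab hb, h'.inv hab hb]
    exact id
  · rw [h.inv hab hb, h'.inv hab hb]
    exact id

theorem Sw.unique_down {x y y' : Equiv.Perm (Fin n)} {i j : ℕ} (h : Sw y x i j)
    (h' : Sw y' x i j) : y = y' := by
  have e : ∀ u, u < n → pos y u = pos y' u := by
    intro u hu
    by_cases h1 : u = i
    · subst h1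
      rw [← h.yj, ← h'.yj]
    · by_cases h2 : u = j
      · subst h2
        rw [← h.yi, ← h'.yi]
      · rw [← h.other u hu h1 h2, ← h'.other u hu h1 h2]
  apply weakLE_antisymm <;> rw [weakLE_iff] <;> intro a b hab hb
  · rw [e a (by omega), e b hb]
    exact id
  · rw [e a (by omega), e b hb]
    exact id

/-- A disagreement between two permutations yields an adjacent one. -/
theorem exists_adj_disagree (x z : Equiv.Perm (Fin n)) (m : ℕ) : ∀ a b, a < n → b < n →
    pos x a + m + 1 = pos x b → pos z b < pos z a →
    ∃ a' b', a' < n ∧ b' < n ∧ pos x b' = pos x a' + 1 ∧ pos z b' < pos z a' := by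
  induction m with
  | zero =>
    intro a b ha hb h1 h2
    exact ⟨a, b, ha, hb, h1.symm, h2⟩
  | succ m ih =>
    intro a b ha hb h1 h2
    obtain ⟨k, hk, hk'⟩ := pos_surj x (pos x a + 1) (by have := pos_lt x hb; omega)
    by_cases h : pos z k < pos z a
    · exact ⟨a, k, ha, hk, hk', h⟩
    · exact ih k b hk hb (by omega) (by omega)

theorem exists_adj_disagree' (x z : Equiv.Perm (Fin n)) {a b : ℕ} (ha : a < n) (hb : b < n)
    (h1 : pos x a < pos x b) (h2 : pos z b < pos z a) :
    ∃ a' b', a' < n ∧ b' < n ∧ pos x b' = pos x a' + 1 ∧ pos z b' < pos z a' :=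
  exists_adj_disagree x z (pos x b - pos x a - 1) a b ha hb (by omega) h2

theorem exists_up {x z : Equiv.Perm (Fin n)} (h : WeakLE x z) (h' : ¬ WeakLE z x) :
    ∃ y i j, Sw x y i j ∧ WeakLE y z := by
  rw [weakLE_iff] at h h'
  push Not at h'
  obtain ⟨a, b, hab, hb, h1, h2⟩ := h'
  have hne : pos x a ≠ pos x b := fun he => by
    have := pos_inj x a b (by omega) hb he
    omega
  obtain ⟨i, j, hi, hj, h3, h4⟩ := exists_adj_disagree' x z (a := a) (b := b) (by omega) hb
    (by omega) h1
  have hij : i < j := by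
    rcases lt_trichotomy i j with hl | hl | hl
    · exact hl
    · subst hl
      omega
    · have := h j i hl hi (by omega)
      omega
  obtain ⟨y, hy⟩ := Sw.exists_up x hij hj h3
  refine ⟨y, i, j, hy, ?_⟩
  rw [weakLE_iff]
  intro a b hab hb hlt
  rcases (hy.inv hab hb).1 hlt with g | ⟨rfl, rfl⟩
  · exact h a b hab hb g
  · exact h4

theorem exists_down {x z : Equiv.Perm (Fin n)} (h : WeakLE z x) (h' : ¬ WeakLE x z) :
    ∃ y i j, Sw y x i j ∧ WeakLE z y := by
  rw [weakLE_iff] at h h'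
  push Not at h'
  obtain ⟨a, b, hab, hb, h1, h2⟩ := h'
  have hne : pos z a ≠ pos z b := fun he => by
    have := pos_inj z a b (by omega) hb he
    omega
  obtain ⟨j, i, hj, hi, h3, h4⟩ := exists_adj_disagree' x z (a := b) (b := a) hb (by omega)
    h1 (by omega)
  have hij : i < j := by
    rcases lt_trichotomy i j with hl | hl | hl
    · exact hl
    · subst hl
      omega
    · have := h j i hl hi (by omega)
      omega
  obtain ⟨y, hy⟩ := Sw.exists_down x hij hj h3
  refine ⟨y, i, j, hy, ?_⟩
  rw [weakLE_iff]
  intro a b hab hb hlt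
  rcases (hy.inv hab hb).1 (h a b hab hb hlt) with g | ⟨rfl, rfl⟩
  · exact g
  · omega

/-- The local contraction criterion. -/
def Contr (ω x y : Equiv.Perm (Fin n)) : Prop :=
  ∃ i j, Sw x y i j ∧
    (setA n (pos ω) i j).card ≤ (setD n (pos ω) (pos x) i j).card

end Perms
section Polygons

variable {n : ℕ}

theorem Sw.up_lt {x y z : Equiv.Perm (Fin n)} {i j : ℕ} (h : Sw x y i j) (hz : WeakLE y z) :
    pos z j < pos z i := by
  refine weakLE_iff.1 hz i j h.lt h.jn ?_
  have := h.adj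
  have := h.yi
  have := h.yj
  omega

theorem Sw.le_of {x y z : Equiv.Perm (Fin n)} {i j : ℕ} (h : Sw x y i j) (hz : WeakLE x z)
    (hl : pos z j < pos z i) : WeakLE y z := by
  rw [weakLE_iff] at hz ⊢
  intro a b hab hb hlt
  rcases (h.inv hab hb).1 hlt with g | ⟨rfl, rfl⟩
  · exact hz a b hab hb g
  · exact hl

theorem Sw.ge_of {x y z : Equiv.Perm (Fin n)} {i j : ℕ} (h : Sw x y i j) (hz : WeakLE z y)
    (hl : pos z i < pos z j) : WeakLE z x := by
  rw [weakLE_iff] at hz ⊢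
  intro a b hab hb hlt
  rcases (h.inv hab hb).1 (hz a b hab hb hlt) with g | ⟨rfl, rfl⟩
  · exact g
  · omega

theorem Sw.down_lt {x y z : Equiv.Perm (Fin n)} {i j : ℕ} (h : Sw x y i j) (hz : WeakLE z x) :
    pos z i < pos z j := by
  by_contra hcon
  have hne : pos z i ≠ pos z j := fun he => by
    have := pos_inj z i j (by have := h.lt; have := h.jn; omega) h.jn he
    have := h.lt
    omega
  have := weakLE_iff.1 hz i j h.lt h.jn (by omega)
  have := h.adj
  omega

theorem setA_sub_right {n : ℕ} {c : ℕ → ℕ} {i j k : ℕ} (h : c k < c j) :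
    (setA n c i k).card ≤ (setA n c i j).card := by
  apply Finset.card_le_card
  intro u
  simp only [setA, Finset.mem_filter]
  rintro ⟨h0, h1, h2⟩
  exact ⟨h0, by omega, by omega⟩

theorem setA_sub_left {n : ℕ} {c : ℕ → ℕ} {i j k : ℕ} (h : i < j) :
    (setA n c i k).card ≤ (setA n c j k).card := by
  apply Finset.card_le_card
  intro u
  simp only [setA, Finset.mem_filter]
  rintro ⟨h0, h1, h2⟩
  exact ⟨h0, by omega, by omega⟩

theorem setD_sub {n : ℕ} {c p p' : ℕ → ℕ} {i j i' j' : ℕ}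
    (h : ∀ u, u < n → i < u → u < j → c j < c u → c u < c i → p u < p i →
      i' < u ∧ u < j' ∧ c j' < c u ∧ c u < c i' ∧ p' u < p' i') :
    (setD n c p i j).card ≤ (setD n c p' i' j').card := by
  apply Finset.card_le_card
  intro u
  simp only [setD, Finset.mem_filter, Finset.mem_range]
  rintro ⟨h0, h1, h2, h3, h4, h5⟩
  exact ⟨h0, h u h0 h1 h2 h3 h4 h5⟩

theorem poly_up {ω x y x1 : Equiv.Perm (Fin n)} {i' j' : ℕ} (hC : Contr ω x y)
    (h1 : Sw x x1 i' j') (hne : x1 ≠ y) (hy : WeakLE y ω) (hx1 : WeakLE x1 ω) :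
    ∃ w1 w, WeakLE x1 w1 ∧ WeakLE w1 w ∧ WeakLE y w ∧
      (∀ z, WeakLE x1 z → WeakLE y z → WeakLE w z) ∧
      (w1 = x1 ∨ Contr ω x1 w1) ∧ Contr ω w1 w := by
  obtain ⟨i, j, h, hcard⟩ := hC
  have ⟨a1, a2, a3, a4, a5, a6⟩ := h
  have ⟨b1, b2, b3, b4, b5, b6⟩ := h1
  have inj := pos_inj x
  have hxz : ∀ z, WeakLE x1 z → WeakLE x z := fun z hz => weakLE_trans h1.le hz
  have c1 := h.up_lt hy
  have c2 := h1.up_lt hx1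
  have n1 : i' ≠ i := by
    rintro rfl
    obtain rfl := inj j' j b2 a2 (by omega)
    exact hne (h1.unique_up h)
  have n2 : j' ≠ j := by
    rintro rfl
    obtain rfl := inj i' i (by omega) (by omega) (by omega)
    exact hne (h1.unique_up h)
  by_cases e1 : i' = j
  · subst e1
    have o1 := b6 i (by omega) (by omega) (by omega)
    obtain ⟨w1, hw1⟩ := Sw.exists_up x1 (i := i) (j := j') (by omega) b2 (by omega)
    have ⟨d1, d2, d3, d4, d5, d6⟩ := hw1
    have o2 := d6 i' (by omega) (by omega) (by omega)
    obtain ⟨w, hw⟩ := Sw.exists_up w1 (i := i) (j := i') (by omega) (by omega) (by omega)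
    refine ⟨w1, w, hw1.le, hw.le, ?_, ?_, Or.inr ⟨i, j', hw1, ?_⟩, i, i', hw, ?_⟩
    · refine h.le_of (weakLE_trans (hxz _ hw1.le) hw.le) ?_
      exact hw.up_lt (fun _ _ _ h => h)
    · intro z hz1 hz2
      have := h.up_lt hz2
      have := h1.up_lt hz1
      exact hw.le_of (hw1.le_of hz1 (by omega)) (by omega)
    · refine (setA_sub_right c2).trans (hcard.trans (setD_sub ?_))
      intro u hu g1 g2 g3 g4 g5
      have := b6 u hu (by omega) (by omega)
      omega
    · refine hcard.trans (setD_sub ?_)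
      intro u hu g1 g2 g3 g4 g5
      have := b6 u hu (by omega) (by omega)
      have := d6 u hu (by omega) (by omega)
      omega
  · by_cases e2 : j' = i
    · subst e2
      have o1 := b6 j (by omega) (by omega) (by omega)
      obtain ⟨w1, hw1⟩ := Sw.exists_up x1 (i := i') (j := j) (by omega) a2 (by omega)
      have ⟨d1, d2, d3, d4, d5, d6⟩ := hw1
      have o2 := d6 j' (by omega) (by omega) (by omega)
      obtain ⟨w, hw⟩ := Sw.exists_up w1 (i := j') (j := j) (by omega) (by omega) (by omega)
      refine ⟨w1, w, hw1.le, hw.le, ?_, ?_, Or.inr ⟨i', j, hw1, ?_⟩, j', j, hw, ?_⟩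
      · refine h.le_of (weakLE_trans (hxz _ hw1.le) hw.le) ?_
        exact hw.up_lt (fun _ _ _ h => h)
      · intro z hz1 hz2
        have := h.up_lt hz2
        have := h1.up_lt hz1
        exact hw.le_of (hw1.le_of hz1 (by omega)) (by omega)
      · refine (setA_sub_left b1).trans (hcard.trans (setD_sub ?_))
        intro u hu g1 g2 g3 g4 g5
        have := b6 u hu (by omega) (by omega)
        omega
      · refine hcard.trans (setD_sub ?_)
        intro u hu g1 g2 g3 g4 g5
        have := b6 u hu (by omega) (by omega)
        have := d6 u hu (by omega) (by omega)
        have := inj u i' (by omega) (by omega)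
        omega
    · have o1 := b6 i (by omega) (by omega) (by omega)
      have o2 := b6 j (by omega) (by omega) (by omega)
      obtain ⟨w, hw⟩ := Sw.exists_up x1 (i := i) (j := j) (by omega) a2 (by omega)
      refine ⟨x1, w, fun _ _ _ h => h, hw.le, ?_, ?_, Or.inl rfl, i, j, hw, ?_⟩
      · refine h.le_of (hxz _ hw.le) ?_
        exact hw.up_lt (fun _ _ _ h => h)
      · intro z hz1 hz2
        exact hw.le_of hz1 (h.up_lt hz2)
      · refine hcard.trans (setD_sub ?_)
        intro u hu g1 g2 g3 g4 g5
        have := inj i i' (by omega) (by omega)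
        have := inj i j' (by omega) (by omega)
        have := inj j i' (by omega) (by omega)
        have := b6 u hu
        by_cases f1 : u = i'
        · subst f1
          omega
        · by_cases f2 : u = j'
          · subst f2
            omega
          · omega

theorem poly_down {ω x y x1 : Equiv.Perm (Fin n)} {i' j' : ℕ} (hC : Contr ω y x)
    (h1 : Sw x1 x i' j') (hne : x1 ≠ y) (hx : WeakLE x ω) :
    ∃ w1 w, WeakLE w1 x1 ∧ WeakLE w w1 ∧ WeakLE w y ∧
      (∀ z, WeakLE z x1 → WeakLE z y → WeakLE z w) ∧
      (w1 = x1 ∨ Contr ω w1 x1) ∧ Contr ω w w1 := by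
  obtain ⟨i, j, h, hcard⟩ := hC
  have ⟨a1, a2, a3, a4, a5, a6⟩ := h
  have ⟨b1, b2, b3, b4, b5, b6⟩ := h1
  have inj := pos_inj x
  have hxz : ∀ z, WeakLE z x1 → WeakLE z x := fun z hz => weakLE_trans hz h1.le
  have c1 := h.up_lt hx
  have c2 := h1.up_lt hx
  have n1 : i' ≠ i := by
    rintro rfl
    obtain rfl := inj j' j b2 a2 (by omega)
    exact hne (h1.unique_down h)
  have n2 : j' ≠ j := by
    rintro rfl
    obtain rfl := inj i' i (by omega) (by omega) (by omega)
    exact hne (h1.unique_down h)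
  by_cases e1 : j' = i
  · subst e1
    have o1 := b6 j (by omega) (by omega) (by omega)
    have o3 := a6 i' (by omega) (by omega) (by omega)
    obtain ⟨w1, hw1⟩ := Sw.exists_down x1 (i := i') (j := j) (by omega) a2 (by omega)
    have ⟨d1, d2, d3, d4, d5, d6⟩ := hw1
    have o2 := d6 j' (by omega) (by omega) (by omega)
    obtain ⟨w, hw⟩ := Sw.exists_down w1 (i := j') (j := j) (by omega) (by omega) (by omega)
    have ⟨f1, f2, f3, f4, f5, f6⟩ := hw
    refine ⟨w1, w, hw1.le, hw.le, ?_, ?_, Or.inr ⟨i', j, hw1, ?_⟩, j', j, hw, ?_⟩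
    · refine h.ge_of (hxz _ (weakLE_trans hw.le hw1.le)) ?_
      omega
    · intro z hz1 hz2
      have := h.down_lt hz2
      have := h1.down_lt hz1
      exact hw.ge_of (hw1.ge_of hz1 (by omega)) (by omega)
    · refine (setA_sub_left b1).trans (hcard.trans (setD_sub ?_))
      intro u hu g1 g2 g3 g4 g5
      have := a6 u hu (by omega) (by omega)
      have := b6 u hu (by omega) (by omega)
      have := d6 u hu (by omega) (by omega)
      omega
    · refine hcard.trans (setD_sub ?_)
      intro u hu g1 g2 g3 g4 g5
      have := a6 u hu (by omega) (by omega)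
      have := b6 u hu (by omega) (by omega)
      have := d6 u hu (by omega) (by omega)
      have := f6 u hu (by omega) (by omega)
      omega
  · by_cases e2 : i' = j
    · subst e2
      have o1 := b6 i (by omega) (by omega) (by omega)
      have o3 := a6 j' (by omega) (by omega) (by omega)
      obtain ⟨w1, hw1⟩ := Sw.exists_down x1 (i := i) (j := j') (by omega) b2 (by omega)
      have ⟨d1, d2, d3, d4, d5, d6⟩ := hw1
      have o2 := d6 i' (by omega) (by omega) (by omega)
      obtain ⟨w, hw⟩ := Sw.exists_down w1 (i := i) (j := i') (by omega) (by omega) (by omega)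
      have ⟨f1, f2, f3, f4, f5, f6⟩ := hw
      refine ⟨w1, w, hw1.le, hw.le, ?_, ?_, Or.inr ⟨i, j', hw1, ?_⟩, i, i', hw, ?_⟩
      · refine h.ge_of (hxz _ (weakLE_trans hw.le hw1.le)) ?_
        omega
      · intro z hz1 hz2
        have := h.down_lt hz2
        have := h1.down_lt hz1
        exact hw.ge_of (hw1.ge_of hz1 (by omega)) (by omega)
      · refine (setA_sub_right c2).trans (hcard.trans (setD_sub ?_))
        intro u hu g1 g2 g3 g4 g5
        have := a6 u hu (by omega) (by omega)
        have := b6 u hu (by omega) (by omega)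
        have := d6 u hu (by omega) (by omega)
        have := inj u i' (by omega) (by omega)
        have := inj u j' (by omega) (by omega)
        omega
      · refine hcard.trans (setD_sub ?_)
        intro u hu g1 g2 g3 g4 g5
        have := a6 u hu (by omega) (by omega)
        have := b6 u hu (by omega) (by omega)
        have := d6 u hu (by omega) (by omega)
        have := f6 u hu (by omega) (by omega)
        have := inj u j' (by omega) (by omega)
        omega
    · have o1 := b6 i (by omega) (by omega) (by omega)
      have o2 := b6 j (by omega) (by omega) (by omega)
      have o3 := a6 i' (by omega) (by omega) (by omega)
      have o4 := a6 j' (by omega) (by omega) (by omega)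
      obtain ⟨w, hw⟩ := Sw.exists_down x1 (i := i) (j := j) (by omega) a2 (by omega)
      have ⟨f1, f2, f3, f4, f5, f6⟩ := hw
      have o5 := f6 i' (by omega) (by omega) (by omega)
      have o6 := f6 j' (by omega) (by omega) (by omega)
      refine ⟨x1, w, fun _ _ _ h => h, hw.le, ?_, ?_, Or.inl rfl, i, j, hw, ?_⟩
      · refine h.ge_of (hxz _ hw.le) ?_
        omega
      · intro z hz1 hz2
        exact hw.ge_of hz1 (h.down_lt hz2)
      · refine hcard.trans (setD_sub ?_)
        intro u hu g1 g2 g3 g4 g5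
        have := inj j i' (by omega) (by omega)
        have := inj j j' (by omega) (by omega)
        have := inj i i' (by omega) (by omega)
        have := inj i j' (by omega) (by omega)
        have := a6 u hu (by omega) (by omega)
        have := f6 u hu (by omega) (by omega)
        have := b6 u hu
        by_cases f1 : u = i'
        · subst f1
          omega
        · by_cases f2 : u = j'
          · subst f2
            omega
          · omega

end Polygons
section Link

variable {n : ℕ}

theorem PipeDream.arc_lt {P : PipeDream n} {i j : ℕ} (h : P.Arc i j) : i < n ∧ j < n := by
  obtain ⟨r, c, h1, h2, rfl, rfl⟩ := h
  obtain ⟨a, b, g1, g2, g3, g4⟩ := P.above_box r c h1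
  exact ⟨P.alive_lt ⟨a, by omega, g3⟩, P.alive_lt ⟨b, by omega, g4⟩⟩

theorem PipeDream.linExt_iff {P : PipeDream n} {x : Equiv.Perm (Fin n)} :
    P.LinExt x ↔ P.Compat (pos x) := by
  constructor
  · intro h i j hij
    obtain ⟨hi, hj⟩ := PipeDream.arc_lt hij
    have := h ⟨i, hi⟩ ⟨j, hj⟩ hij
    simpa [pos, hi, hj] using this
  · intro h i j hij
    have := h _ _ hij
    rwa [pos_fin, pos_fin] at this

theorem PipeDream.hasExitPerm_iff {P : PipeDream n} {ω : Equiv.Perm (Fin n)} :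
    P.HasExitPerm ω ↔ P.Exits (pos ω) := by
  constructor
  · intro h
    refine ⟨fun u hu => pos_lt ω hu, ?_, ?_⟩
    · intro u hu
      have := h (ω⁻¹ ⟨u, hu⟩)
      rw [← pos_fin] at this
      simpa using this
    · intro t ht
      have := h ⟨t, ht⟩
      simp only at this
      rw [this, pos_fin]
      simp
  · intro h c
    have h1 := h.exit_col (ω c).val (ω c).isLt
    rw [pos_fin] at h1
    simpa using h1

theorem PipeDream.Compat.acyclic {P : PipeDream n} {p : ℕ → ℕ} (h : P.Compat p) :
    P.Acyclic := by
  have key : ∀ i j, Relation.TransGen P.Arc i j → p i < p j := by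
    intro i j hij
    induction hij with
    | single h1 => exact h _ _ h1
    | tail _ h1 ih => exact ih.trans (h _ _ h1)
  intro i hi
  exact lt_irrefl _ (key i i hi)

theorem exists_pd {ω x : Equiv.Perm (Fin n)} (hx : WeakLE x ω) :
    ∃ P : PipeDream n, P.Exits (pos ω) ∧ P.Reduced ∧ P.Compat (pos x) :=
  PipeDream.exists_greedy (fun _ hu => pos_lt ω hu) (pos_inj ω) (pos_surj ω) (pos_inj x)
    (weakLE_iff.1 hx)

theorem pdEquiv_of {ω x y : Equiv.Perm (Fin n)} {P : PipeDream n} (h1 : P.Exits (pos ω))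
    (h2 : P.Reduced) (h3 : P.Compat (pos x)) (h4 : P.Compat (pos y)) : PDEquiv ω x y :=
  ⟨P, h2, PipeDream.hasExitPerm_iff.2 h1, h3.acyclic, PipeDream.linExt_iff.2 h3,
    PipeDream.linExt_iff.2 h4⟩

theorem pdEquiv_refl {ω x : Equiv.Perm (Fin n)} (hx : WeakLE x ω) : PDEquiv ω x x := by
  obtain ⟨P, h1, h2, h3⟩ := exists_pd hx
  exact pdEquiv_of h1 h2 h3 h3

theorem pdEquiv_symm {ω x y : Equiv.Perm (Fin n)} (h : PDEquiv ω x y) : PDEquiv ω y x := by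
  obtain ⟨P, h1, h2, h3, h4, h5⟩ := h
  exact ⟨P, h1, h2, h3, h5, h4⟩

theorem pdEquiv_trans {ω x y z : Equiv.Perm (Fin n)} (h : PDEquiv ω x y)
    (h' : PDEquiv ω y z) : PDEquiv ω x z := by
  obtain ⟨P, h1, h2, h3, h4, h5⟩ := h
  obtain ⟨Q, g1, g2, g3, g4, g5⟩ := h'
  rw [PipeDream.hasExitPerm_iff] at h2 g2
  rw [PipeDream.linExt_iff] at h4 h5 g4 g5
  obtain rfl := PipeDream.Exits.unique h2 h1 h5 (pos_inj y) g2 g1 g4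
  exact pdEquiv_of h2 h1 h4 g5

theorem Contr.pdEquiv {ω x y : Equiv.Perm (Fin n)} (h : Contr ω x y) (hy : WeakLE y ω) :
    PDEquiv ω x y := by
  obtain ⟨i, j, hs, hcard⟩ := h
  have hx := weakLE_trans hs.le hy
  obtain ⟨P, h1, h2, h3⟩ := exists_pd hx
  refine pdEquiv_of h1 h2 h3 ?_
  have hno := h1.imp_noarc h2 h3 (pos_inj x) hs.lt (hs.up_lt hy) hcard
  intro u v huv
  obtain ⟨hu, hv⟩ := PipeDream.arc_lt huv
  have hlt := h3 u v huv
  rcases lt_trichotomy u v with g | g | g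
  · by_contra hcon
    have hne : pos y u ≠ pos y v := fun he => by
      have := pos_inj y u v hu hv he
      omega
    rcases (hs.inv g hv).1 (by omega) with g' | ⟨rfl, rfl⟩
    · omega
    · exact hno huv
  · subst g
    omega
  · exact (hs.inv g hu).2 (Or.inl hlt)

/-- The set of disagreements of two permutations. -/
def disag (x y : Equiv.Perm (Fin n)) : Finset (ℕ × ℕ) :=
  (Finset.range n ×ˢ Finset.range n).filter
    (fun q => pos x q.1 < pos x q.2 ∧ pos y q.2 < pos y q.1)

theorem mem_disag {x y : Equiv.Perm (Fin n)} {u v : ℕ} : (u, v) ∈ disag x y ↔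
    (u < n ∧ v < n) ∧ pos x u < pos x v ∧ pos y v < pos y u := by
  simp [disag]

theorem eq_of_disag {x y : Equiv.Perm (Fin n)} (h : disag x y = ∅) : x = y := by
  have key : ∀ u v, u < n → v < n → pos x u < pos x v → pos y u < pos y v := by
    intro u v hu hv hlt
    by_contra hcon
    have hne : pos y u ≠ pos y v := fun he => by
      have := pos_inj y u v hu hv he
      subst this
      omega
    have : (u, v) ∈ disag x y := mem_disag.2 ⟨⟨hu, hv⟩, hlt, by omega⟩
    rw [h] at this
    simp at this
  apply weakLE_antisymm
  · rw [weakLE_iff]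
    intro a b hab hb hlt
    exact key b a hb (by omega) hlt
  · rw [weakLE_iff]
    intro a b hab hb hlt
    by_contra hcon
    have hne : pos x a ≠ pos x b := fun he => by
      have := pos_inj x a b (by omega) hb he
      omega
    have := key a b (by omega) hb (by omega)
    omega

/-- The contraction relation on the interval below `ω`. -/
def ContrI (ω : Equiv.Perm (Fin n)) (x y : {π : Equiv.Perm (Fin n) // WeakLE π ω}) : Prop :=
  Contr ω x.1 y.1

theorem eqvGen_of_common {ω : Equiv.Perm (Fin n)} {P : PipeDream n} (h1 : P.Exits (pos ω))
    (h2 : P.Reduced) (b : {π : Equiv.Perm (Fin n) // WeakLE π ω}) (hb : P.Compat (pos b.1))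
    (m : ℕ) : ∀ a : {π : Equiv.Perm (Fin n) // WeakLE π ω}, P.Compat (pos a.1) →
      (disag a.1 b.1).card ≤ m → Relation.EqvGen (ContrI ω) a b := by
  induction m with
  | zero =>
    intro a ha hm
    have : a = b := Subtype.ext (eq_of_disag (Finset.card_eq_zero.1 (by omega)))
    subst this
    exact Relation.EqvGen.refl _
  | succ m ih =>
    intro a ha hm
    by_cases he : disag a.1 b.1 = ∅
    · have : a = b := Subtype.ext (eq_of_disag he)
      subst this
      exact Relation.EqvGen.refl _
    · obtain ⟨⟨u0, v0⟩, hq⟩ := Finset.nonempty_iff_ne_empty.2 he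
      obtain ⟨⟨hu0, hv0⟩, hq1, hq2⟩ := mem_disag.1 hq
      obtain ⟨i, j, hi, hj, hadj, hbij⟩ := exists_adj_disagree' a.1 b.1 hu0 hv0 hq1 hq2
      obtain ⟨y, y1, y2, y3⟩ := pos_swap a.1 hi hj
      have hij : i ≠ j := by
        rintro rfl
        omega
      have hord : ∀ u v, u < n → v < n → ¬ (u = i ∧ v = j) → ¬ (u = j ∧ v = i) →
          (pos y u < pos y v ↔ pos a.1 u < pos a.1 v) := by
        intro u v hu hv n1 n2
        have i1 := pos_inj a.1 u i hu hi
        have i2 := pos_inj a.1 u j hu hj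
        have i3 := pos_inj a.1 v i hv hi
        have i4 := pos_inj a.1 v j hv hj
        have o1 := y3 u hu
        have o2 := y3 v hv
        by_cases e1 : u = i <;> by_cases e2 : u = j <;> by_cases e3 : v = i <;>
          by_cases e4 : v = j <;> grind
      have hcomp : P.Compat (pos y) := by
        intro u v huv
        obtain ⟨hu, hv⟩ := PipeDream.arc_lt huv
        have g1 := ha u v huv
        have g2 := hb u v huv
        refine (hord u v hu hv ?_ ?_).2 g1
        · rintro ⟨rfl, rfl⟩
          omega
        · rintro ⟨rfl, rfl⟩
          omega
      have hyω : WeakLE y ω ∧ (Contr ω a.1 y ∨ Contr ω y a.1) := by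
        rcases lt_or_gt_of_ne hij with hl | hl
        · have hs : Sw a.1 y i j := ⟨hl, hj, hadj, y1, y2, y3⟩
          have hω := weakLE_iff.1 b.2 i j hl hj hbij
          refine ⟨hs.le_of a.2 hω, Or.inl ⟨i, j, hs, ?_⟩⟩
          refine h1.noarc_imp h2 ha (pos_inj a.1) (weakLE_iff.1 a.2) hl hj (by omega) ?_ hω ?_
          · intro u hu hlt
            omega
          · intro harc
            have := hb i j harc
            omega
        · have hs : Sw y a.1 j i := ⟨hl, hi, by omega, by omega, by omega,
            fun u hu g1 g2 => (y3 u hu g2 g1).symm⟩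
          have hω := weakLE_iff.1 a.2 j i hl hi (by omega)
          have hy := weakLE_trans hs.le a.2
          refine ⟨hy, Or.inr ⟨j, i, hs, ?_⟩⟩
          refine h1.noarc_imp h2 hcomp (pos_inj y) (weakLE_iff.1 hy) hl hi (by omega) ?_ hω ?_
          · intro u hu hlt
            omega
          · intro harc
            have := ha j i harc
            omega
      obtain ⟨hy, hc⟩ := hyω
      have hlt : (disag y b.1).card < (disag a.1 b.1).card := by
        apply Finset.card_lt_card
        rw [Finset.ssubset_iff_of_subset]
        · refine ⟨(i, j), mem_disag.2 ⟨⟨hi, hj⟩, by omega, hbij⟩, ?_⟩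
          rw [mem_disag]
          omega
        · rintro ⟨u, v⟩ huv
          obtain ⟨⟨hu, hv⟩, g1, g2⟩ := mem_disag.1 huv
          refine mem_disag.2 ⟨⟨hu, hv⟩, ?_, g2⟩
          refine (hord u v hu hv ?_ ?_).1 g1
          · rintro ⟨rfl, rfl⟩
            omega
          · rintro ⟨rfl, rfl⟩
            omega
      have hrec := ih ⟨y, hy⟩ hcomp (by simp only; omega)
      refine Relation.EqvGen.trans _ _ _ ?_ hrec
      rcases hc with hc | hc
      · exact Relation.EqvGen.rel _ _ hc
      · exact Relation.EqvGen.symm _ _ (Relation.EqvGen.rel _ _ hc)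

theorem eqvGen_of_pdEquiv {ω : Equiv.Perm (Fin n)}
    (a b : {π : Equiv.Perm (Fin n) // WeakLE π ω}) (h : PDEquiv ω a.1 b.1) :
    Relation.EqvGen (ContrI ω) a b := by
  obtain ⟨P, h1, h2, h3, h4, h5⟩ := h
  exact eqvGen_of_common (PipeDream.hasExitPerm_iff.1 h2) h1 b (PipeDream.linExt_iff.1 h5) _ a
    (PipeDream.linExt_iff.1 h4) le_rfl

theorem pdEquiv_of_eqvGen {ω : Equiv.Perm (Fin n)}
    (a b : {π : Equiv.Perm (Fin n) // WeakLE π ω}) (h : Relation.EqvGen (ContrI ω) a b) :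
    PDEquiv ω a.1 b.1 := by
  induction h with
  | rel x y h => exact Contr.pdEquiv h y.2
  | refl x => exact pdEquiv_refl x.2
  | symm x y _ ih => exact pdEquiv_symm ih
  | trans x y z _ _ ih1 ih2 => exact pdEquiv_trans ih1 ih2

end Link

/-- For any permutation `ω ∈ S_n`, the pipe dream congruence `≡_ω`
is a lattice congruence of the weak order interval `[e, ω]` : given the meet `⊓` and
join `⊔` operations of the lattice `[e, ω]` (i.e. binary operations computing
greatest lower bounds and least upper bounds in `[e, ω]` for the weak order), if
`π ≡_ω π'` and `σ ≡_ω σ'` then `π ⊓ σ ≡_ω π' ⊓ σ'` and `π ⊔ σ ≡_ω π' ⊔ σ'`. -/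
theorem pipeDream_congruence (n : ℕ) (ω : Equiv.Perm (Fin n))
    (meet join : Equiv.Perm (Fin n) → Equiv.Perm (Fin n) → Equiv.Perm (Fin n))
    (hmeet : ∀ a b : Equiv.Perm (Fin n), WeakLE a ω → WeakLE b ω →
      WeakLE (meet a b) a ∧ WeakLE (meet a b) b ∧
      ∀ c : Equiv.Perm (Fin n), WeakLE c ω → WeakLE c a → WeakLE c b →
        WeakLE c (meet a b))
    (hjoin : ∀ a b : Equiv.Perm (Fin n), WeakLE a ω → WeakLE b ω →
      WeakLE (join a b) ω ∧ WeakLE a (join a b) ∧ WeakLE b (join a b) ∧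
      ∀ c : Equiv.Perm (Fin n), WeakLE c ω → WeakLE a c → WeakLE b c →
        WeakLE (join a b) c)
    (π π' σ σ' : Equiv.Perm (Fin n))
    (hπ : WeakLE π ω) (hπ' : WeakLE π' ω) (hσ : WeakLE σ ω) (hσ' : WeakLE σ' ω)
    (h1 : PDEquiv ω π π') (h2 : PDEquiv ω σ σ') :
    PDEquiv ω (meet π σ) (meet π' σ') ∧ PDEquiv ω (join π σ) (join π' σ') := by
  have hml : ∀ a b : {π : Equiv.Perm (Fin n) // WeakLE π ω}, WeakLE (meet a.1 b.1) ω :=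
    fun a b => weakLE_trans (hmeet a.1 b.1 a.2 b.2).1 a.2
  let _ : Lattice {π : Equiv.Perm (Fin n) // WeakLE π ω} :=
    { le := fun a b => WeakLE a.1 b.1
      le_refl := fun a _ _ _ h => h
      le_trans := fun a b c => weakLE_trans
      le_antisymm := fun a b h h' => Subtype.ext (weakLE_antisymm h h')
      sup := fun a b => ⟨join a.1 b.1, (hjoin a.1 b.1 a.2 b.2).1⟩
      inf := fun a b => ⟨meet a.1 b.1, hml a b⟩
      le_sup_left := fun a b => (hjoin a.1 b.1 a.2 b.2).2.1
      le_sup_right := fun a b => (hjoin a.1 b.1 a.2 b.2).2.2.1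
      sup_le := fun a b c h h' => (hjoin a.1 b.1 a.2 b.2).2.2.2 c.1 c.2 h h'
      inf_le_left := fun a b => (hmeet a.1 b.1 a.2 b.2).1
      inf_le_right := fun a b => (hmeet a.1 b.1 a.2 b.2).2.1
      le_inf := fun a b c h h' => (hmeet b.1 c.1 b.2 c.2).2.2 a.1 a.2 h h' }
  have hle : ∀ a b : {π : Equiv.Perm (Fin n) // WeakLE π ω}, a ≤ b ↔ WeakLE a.1 b.1 :=
    fun a b => Iff.rfl
  have hlt : ∀ a b : {π : Equiv.Perm (Fin n) // WeakLE π ω},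
      a < b ↔ WeakLE a.1 b.1 ∧ ¬ WeakLE b.1 a.1 := fun a b => lt_iff_le_not_ge
  let step : {π : Equiv.Perm (Fin n) // WeakLE π ω} →
    {π : Equiv.Perm (Fin n) // WeakLE π ω} → Prop := fun a b => ∃ i j, Sw a.1 b.1 i j
  have hstep : ∀ x y, step x y → x < y := by
    rintro x y ⟨i, j, h⟩
    exact (hlt x y).2 ⟨h.le, h.not_le⟩
  have hCs : ∀ x y, ContrI ω x y → step x y := by
    rintro x y ⟨i, j, h, _⟩
    exact ⟨i, j, h⟩
  have g1 := eqvGen_of_pdEquiv ⟨π, hπ⟩ ⟨π', hπ'⟩ h1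
  have g2 := eqvGen_of_pdEquiv ⟨σ, hσ⟩ ⟨σ', hσ'⟩ h2
  constructor
  · refine pdEquiv_of_eqvGen _ _ (meet_cong step (ContrI ω) hstep hCs ?_ ?_ g1 g2)
    · intro x z h
      obtain ⟨ha, hb⟩ := (hlt z x).1 h
      obtain ⟨y, i, j, hs, hz⟩ := exists_down ha hb
      exact ⟨⟨y, weakLE_trans hs.le x.2⟩, ⟨i, j, hs⟩, hz⟩
    · rintro x y x1 hC ⟨i', j', hs⟩ hne
      obtain ⟨w1, w, k1, k2, k3, k4, k5, k6⟩ :=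
        poly_down hC hs (fun he => hne (Subtype.ext he)) x.2
      have hw1 : WeakLE w1 ω := weakLE_trans k1 x1.2
      have hw : WeakLE w ω := weakLE_trans k2 hw1
      have heq : x1 ⊓ y = ⟨w, hw⟩ := by
        apply le_antisymm
        · exact k4 _ (inf_le_left : x1 ⊓ y ≤ x1) (inf_le_right : x1 ⊓ y ≤ y)
        · refine le_inf ?_ ?_
          · exact weakLE_trans k2 k1
          · exact k3
      rw [heq]
      rcases k5 with rfl | k5
      · exact Relation.ReflTransGen.single k6
      · have m1 : ContrI ω ⟨w1, hw1⟩ x1 := k5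
        have m2 : ContrI ω ⟨w, hw⟩ ⟨w1, hw1⟩ := k6
        exact Relation.ReflTransGen.tail (Relation.ReflTransGen.single m1) m2
  · refine pdEquiv_of_eqvGen _ _ (join_cong step (ContrI ω) hstep hCs ?_ ?_ g1 g2)
    · intro x z h
      obtain ⟨ha, hb⟩ := (hlt x z).1 h
      obtain ⟨y, i, j, hs, hz⟩ := exists_up ha hb
      exact ⟨⟨y, weakLE_trans hz z.2⟩, ⟨i, j, hs⟩, hz⟩
    · rintro x y x1 hC ⟨i', j', hs⟩ hne
      obtain ⟨w1, w, k1, k2, k3, k4, k5, k6⟩ :=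
        poly_up hC hs (fun he => hne (Subtype.ext he)) y.2 x1.2
      have hw : WeakLE w ω := k4 ω x1.2 y.2
      have hw1 : WeakLE w1 ω := weakLE_trans k2 hw
      have heq : x1 ⊔ y = ⟨w, hw⟩ := by
        apply le_antisymm
        · refine sup_le ?_ ?_
          · exact weakLE_trans k1 k2
          · exact k3
        · exact k4 _ (le_sup_left : x1 ≤ x1 ⊔ y) (le_sup_right : y ≤ x1 ⊔ y)
      rw [heq]
      rcases k5 with rfl | k5
      · exact Relation.ReflTransGen.single k6
      · have m1 : ContrI ω x1 ⟨w1, hw1⟩ := k5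
        have m2 : ContrI ω ⟨w1, hw1⟩ ⟨w, hw⟩ := k6
        exact Relation.ReflTransGen.tail (Relation.ReflTransGen.single m1) m2
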